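/- Let n ≥ 4. The braid group B_n on n strands is not abstractly commensurable with the right-angled Artin group A(Γ) of any finite simple graph Γ. -/

import Mathlib

/-- The defining relators of the right-angled Artin group on the simple graph `Γ`:
one commutator relator for each edge of `Γ`. -/
def raagRels {V : Type*} (Γ : SimpleGraph V) : Set (FreeGroup V) :=
  {r : FreeGroup V | ∃ u w : V, Γ.Adj u w ∧
    r = FreeGroup.of u * FreeGroup.of w * (FreeGroup.of u)⁻¹ * (FreeGroup.of w)⁻¹}

/-- The right-angled Artin group of a simple graph `Γ`: the presented group with one
generator for each vertex of `Γ` and a commutator relator for each edge of `Γ`. -/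
abbrev RAAG {V : Type*} (Γ : SimpleGraph V) : Type _ :=
  PresentedGroup (raagRels Γ)

/-- Two groups are abstractly commensurable if they have isomorphic finite-index
subgroups. -/
def AbstractlyCommensurable (G H : Type*) [Group G] [Group H] : Prop :=
  ∃ (G' : Subgroup G) (H' : Subgroup H),
    G'.FiniteIndex ∧ H'.FiniteIndex ∧ Nonempty (G' ≃* H')

/-- The defining relators of the braid group on `n` strands: the braid relations
`σᵢσᵢ₊₁σᵢ = σᵢ₊₁σᵢσᵢ₊₁` and the commutation relations `σᵢσⱼ = σⱼσᵢ` for `|i - j| ≥ 2`. -/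
def braidRels (n : ℕ) : Set (FreeGroup (Fin (n - 1))) :=
  {r : FreeGroup (Fin (n - 1)) |
    (∃ i j : Fin (n - 1), (i : ℕ) + 1 = (j : ℕ) ∧
        r = FreeGroup.of i * FreeGroup.of j * FreeGroup.of i *
            (FreeGroup.of j * FreeGroup.of i * FreeGroup.of j)⁻¹) ∨
    (∃ i j : Fin (n - 1), (i : ℕ) + 2 ≤ (j : ℕ) ∧
        r = FreeGroup.of i * FreeGroup.of j * (FreeGroup.of i)⁻¹ * (FreeGroup.of j)⁻¹)}

/-- The braid group on `n` strands, presented with generators `σ₁, …, σₙ₋₁` and the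
braid and commutation relators. -/
abbrev BraidGroup (n : ℕ) : Type :=
  PresentedGroup (braidRels n)

namespace RAAG

variable {V : Type*} {Γ : SimpleGraph V}

/-- The standard generator attached to a vertex. -/
def gen (v : V) : RAAG Γ := PresentedGroup.of v

theorem commute_gen {u w : V} (h : Γ.Adj u w) : Commute (gen u : RAAG Γ) (gen w) := by
  have h1 : PresentedGroup.mk (raagRels Γ)
      (FreeGroup.of u * FreeGroup.of w * (FreeGroup.of u)⁻¹ * (FreeGroup.of w)⁻¹) = 1 :=
    PresentedGroup.one_of_mem ⟨u, w, h, rfl⟩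
  simp only [map_mul, map_inv] at h1
  exact commutatorElement_eq_one_iff_commute.1 h1

/-- The universal property of a right-angled Artin group. -/
def lift {G : Type*} [Group G] (f : V → G) (hf : ∀ u w, Γ.Adj u w → Commute (f u) (f w)) :
    RAAG Γ →* G :=
  PresentedGroup.toGroup (f := f) (by
    rintro r ⟨u, w, h, rfl⟩
    simpa [commutatorElement_def] using commutatorElement_eq_one_iff_commute.2 (hf u w h))

@[simp] theorem lift_gen {G : Type*} [Group G] (f : V → G)
    (hf : ∀ u w, Γ.Adj u w → Commute (f u) (f w)) (v : V) : lift f hf (gen v) = f v :=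
  PresentedGroup.toGroup.of _

theorem induction_gen {p : RAAG Γ → Prop} (one : p 1) (gen : ∀ v, p (gen v))
    (mul : ∀ g h, p g → p h → p (g * h)) (inv : ∀ g, p g → p g⁻¹) (g : RAAG Γ) : p g := by
  have hg : g ∈ Subgroup.closure (Set.range (PresentedGroup.of : V → RAAG Γ)) := by
    rw [PresentedGroup.closure_range_of]; trivial
  induction hg using Subgroup.closure_induction with
  | mem x hx => obtain ⟨v, rfl⟩ := hx; exact gen v
  | one => exact one
  | mul x y _ _ hx hy => exact mul x y hx hy
  | inv x _ hx => exact inv x hx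

/-- The special subgroup generated by a set of vertices. -/
def special (Γ : SimpleGraph V) (S : Set V) : Subgroup (RAAG Γ) := Subgroup.closure (gen '' S)

theorem gen_mem_special {S : Set V} {v : V} (hv : v ∈ S) : gen v ∈ special Γ S :=
  Subgroup.subset_closure ⟨v, hv, rfl⟩

theorem special_mono {S T : Set V} (h : S ⊆ T) : special Γ S ≤ special Γ T :=
  Subgroup.closure_mono (Set.image_mono h)

theorem special_induction {S : Set V} {p : RAAG Γ → Prop} (one : p 1) (gen : ∀ v ∈ S, p (gen v))
    (mul : ∀ g h, p g → p h → p (g * h)) (inv : ∀ g, p g → p g⁻¹) {g : RAAG Γ}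
    (hg : g ∈ special Γ S) : p g := by
  induction hg using Subgroup.closure_induction with
  | mem x hx => obtain ⟨v, hv, rfl⟩ := hx; exact gen v hv
  | one => exact one
  | mul x y _ _ hx hy => exact mul x y hx hy
  | inv x _ hx => exact inv x hx

open scoped Classical in
/-- The retraction onto a special subgroup killing all other generators. -/
noncomputable def retr (S : Set V) : RAAG Γ →* RAAG Γ :=
  lift (fun v => if v ∈ S then gen v else 1) (by
    intro u w h
    split_ifs
    exacts [commute_gen h, Commute.one_right _, Commute.one_left _, Commute.one_left _])

theorem retr_gen_of_mem {S : Set V} {v : V} (hv : v ∈ S) :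
    retr S (gen v : RAAG Γ) = gen v := by
  simp [retr, hv]

theorem retr_gen_of_notMem {S : Set V} {v : V} (hv : v ∉ S) :
    retr S (gen v : RAAG Γ) = 1 := by
  simp [retr, hv]

theorem retr_eq_self {S : Set V} {g : RAAG Γ} (hg : g ∈ special Γ S) : retr S g = g :=
  special_induction (p := fun g => retr S g = g) (map_one _) (fun _ hv => retr_gen_of_mem hv)
    (fun g h hg hh => by rw [map_mul, hg, hh]) (fun g hg => by rw [map_inv, hg]) hg

theorem retr_mem_inter {S T : Set V} {g : RAAG Γ} (hg : g ∈ special Γ T) :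
    retr S g ∈ special Γ (S ∩ T) := by
  refine special_induction (p := fun g => retr S g ∈ special Γ (S ∩ T)) (by simp) (fun v hv => ?_)
    (fun g h hg hh => by rw [map_mul]; exact mul_mem hg hh)
    (fun g hg => by rw [map_inv]; exact inv_mem hg) hg
  by_cases h : v ∈ S
  · rw [retr_gen_of_mem h]; exact gen_mem_special ⟨h, hv⟩
  · rw [retr_gen_of_notMem h]; exact one_mem _

theorem special_univ : special Γ Set.univ = ⊤ := by
  rw [special, Set.image_univ]; exact PresentedGroup.closure_range_of _

theorem retr_mem (S : Set V) (g : RAAG Γ) : retr S g ∈ special Γ S := by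
  have h : g ∈ special Γ Set.univ := by simp [special_univ]
  simpa using retr_mem_inter (S := S) h

theorem retr_eq_one {S T : Set V} (hST : Disjoint S T) {g : RAAG Γ} (hg : g ∈ special Γ T) :
    retr S g = 1 := by
  have h := retr_mem_inter (S := S) hg
  rw [hST.inter_eq] at h
  simpa [special] using h

theorem commute_of_mem_special {X Y : Set V} (hXY : ∀ x ∈ X, ∀ y ∈ Y, Γ.Adj x y) {g h : RAAG Γ}
    (hg : g ∈ special Γ X) (hh : h ∈ special Γ Y) : Commute g h := by
  refine special_induction (p := fun g => Commute g h) (Commute.one_left _) (fun x hx => ?_)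
    (fun _ _ => Commute.mul_left) (fun _ => Commute.inv_left) hg
  exact special_induction (p := fun h => Commute (gen x) h) (Commute.one_right _)
    (fun y hy => commute_gen (hXY x hx y hy))
    (fun _ _ => Commute.mul_right) (fun _ => Commute.inv_right) hh

theorem disjoint_of_join {X Y : Set V} (hXY : ∀ x ∈ X, ∀ y ∈ Y, Γ.Adj x y) : Disjoint X Y :=
  Set.disjoint_left.2 fun a ha hb => Γ.irrefl (hXY a ha a hb)

theorem eq_retr_mul_retr {X Y : Set V} (hXY : ∀ x ∈ X, ∀ y ∈ Y, Γ.Adj x y) {g : RAAG Γ}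
    (hg : g ∈ special Γ (X ∪ Y)) : g = retr X g * retr Y g := by
  have hd := disjoint_of_join hXY
  refine special_induction (p := fun g => g = retr X g * retr Y g) (by simp) ?_ ?_ ?_ hg
  · rintro v (hv | hv)
    · rw [retr_gen_of_mem hv, retr_gen_of_notMem (Set.disjoint_left.1 hd hv), mul_one]
    · rw [retr_gen_of_mem hv, retr_gen_of_notMem (Set.disjoint_right.1 hd hv), one_mul]
  · intro g h hg hh
    have := commute_of_mem_special hXY (retr_mem X h) (retr_mem Y g)
    rw [map_mul, map_mul, mul_assoc, ← mul_assoc (retr X h), this.eq, mul_assoc, ← mul_assoc,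
      ← hg, ← hh]
  · intro g hg
    have := commute_of_mem_special hXY (retr_mem X g) (retr_mem Y g)
    rw [map_inv, map_inv, ← mul_inv_rev, ← this.eq, ← hg]

/-! ### Word length -/

/-- The group element represented by a letter; `true` stands for exponent `1`. -/
def letter (a : V × Bool) : RAAG Γ := bif a.2 then gen a.1 else (gen a.1)⁻¹

/-- The group element represented by a word. -/
def eval (w : List (V × Bool)) : RAAG Γ := (w.map letter).prod

@[simp] theorem eval_nil : eval ([] : List (V × Bool)) = (1 : RAAG Γ) := rfl

@[simp] theorem eval_cons (a : V × Bool) (w : List (V × Bool)) :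
    (eval (a :: w) : RAAG Γ) = letter a * eval w := by simp [eval]

@[simp] theorem eval_append (w w' : List (V × Bool)) :
    (eval (w ++ w') : RAAG Γ) = eval w * eval w' := by simp [eval]

theorem exists_eval (g : RAAG Γ) : ∃ w, eval w = g := by
  refine induction_gen (p := fun g => ∃ w, eval w = g) ⟨[], rfl⟩
    (fun v => ⟨[(v, true)], by simp [letter]⟩) ?_ ?_ g
  · rintro _ _ ⟨w, rfl⟩ ⟨w', rfl⟩
    exact ⟨w ++ w', by simp⟩
  · rintro _ ⟨w, rfl⟩
    induction w with
    | nil => exact ⟨[], by simp⟩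
    | cons a w ih =>
      obtain ⟨w', hw'⟩ := ih
      refine ⟨w' ++ [(a.1, !a.2)], ?_⟩
      rcases a with ⟨v, _ | _⟩ <;> simp [hw', letter]

open scoped Classical in
/-- The word length with respect to the standard generators. -/
noncomputable def len (g : RAAG Γ) : ℕ :=
  Nat.find (p := fun n => ∃ w : List (V × Bool), w.length = n ∧ eval w = g)
    (let ⟨w, hw⟩ := exists_eval g; ⟨_, w, rfl, hw⟩)

open scoped Classical in
theorem exists_eval_length (g : RAAG Γ) : ∃ w : List (V × Bool), w.length = len g ∧ eval w = g :=
  Nat.find_spec (p := fun n => ∃ w : List (V × Bool), w.length = n ∧ eval w = g) _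

open scoped Classical in
theorem len_eval_le (w : List (V × Bool)) : len (eval w : RAAG Γ) ≤ w.length :=
  Nat.find_min' _ ⟨w, rfl, rfl⟩

theorem len_mul_le (g h : RAAG Γ) : len (g * h) ≤ len g + len h := by
  obtain ⟨w, hw, rfl⟩ := exists_eval_length g
  obtain ⟨w', hw', rfl⟩ := exists_eval_length h
  rw [← hw, ← hw', ← List.length_append, ← eval_append]
  exact len_eval_le _

@[simp] theorem len_one : len (1 : RAAG Γ) = 0 := by
  simpa using len_eval_le (Γ := Γ) []

theorem eq_one_of_len_eq_zero {g : RAAG Γ} (h : len g = 0) : g = 1 := by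
  obtain ⟨w, hw, rfl⟩ := exists_eval_length g
  rw [h, List.length_eq_zero_iff] at hw
  simp [hw]

theorem len_pow_le (g : RAAG Γ) (n : ℕ) : len (g ^ n) ≤ n * len g := by
  induction n with
  | zero => simp
  | succ n ih =>
    rw [pow_succ, add_mul, one_mul]
    exact (len_mul_le _ _).trans (by omega)

theorem len_letter_le (a : V × Bool) : len (letter a : RAAG Γ) ≤ 1 := by
  simpa using len_eval_le (Γ := Γ) [a]

open scoped Classical in
theorem retr_eval (S : Set V) (w : List (V × Bool)) :
    retr S (eval w : RAAG Γ) = eval (w.filter (fun a => a.1 ∈ S)) := by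
  induction w with
  | nil => simp
  | cons a w ih =>
    by_cases h : a.1 ∈ S
    · rcases a with ⟨v, _ | _⟩ <;> simp [h, ih, letter, retr_gen_of_mem h]
    · rcases a with ⟨v, _ | _⟩ <;> simp [h, ih, letter, retr_gen_of_notMem h]

theorem len_retr_eval_le (S : Set V) (w : List (V × Bool)) :
    len (retr S (eval w : RAAG Γ)) ≤ w.length := by
  classical
  rw [retr_eval]
  exact (len_eval_le _).trans (List.length_filter_le _ _)

theorem len_retr_eval_lt {S : Set V} {w : List (V × Bool)} {a : V × Bool} (ha : a ∈ w)
    (haS : a.1 ∉ S) : len (retr S (eval w : RAAG Γ)) < w.length := by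
  classical
  rw [retr_eval]
  refine (len_eval_le _).trans_lt ?_
  rw [List.length_filter_lt_length_iff_exists]
  exact ⟨a, ha, by simpa using haS⟩

theorem len_retr_le (S : Set V) (g : RAAG Γ) : len (retr S g) ≤ len g := by
  obtain ⟨w, hw, rfl⟩ := exists_eval_length g
  rw [← hw]
  exact len_retr_eval_le S w

theorem eval_mem_special {S : Set V} {w : List (V × Bool)} (h : ∀ a ∈ w, a.1 ∈ S) :
    eval w ∈ special Γ S := by
  refine Subgroup.list_prod_mem _ fun x hx => ?_
  obtain ⟨a, ha, rfl⟩ := List.mem_map.1 hx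
  have := gen_mem_special (Γ := Γ) (h a ha)
  rcases a with ⟨v, _ | _⟩
  · exact inv_mem this
  · exact this

theorem fst_mem_of_geodesic {S : Set V} {w : List (V × Bool)}
    (hw : w.length = len (eval w : RAAG Γ))
    (hS : eval w ∈ special Γ S) : ∀ a ∈ w, a.1 ∈ S := by
  intro a ha
  by_contra h
  have := len_retr_eval_lt (Γ := Γ) ha h
  rw [retr_eq_self hS] at this
  omega

theorem mem_special_of_len_le {S : Set V} {g : RAAG Γ} (h : len g ≤ len (retr S g)) :
    g ∈ special Γ S := by
  obtain ⟨w, hw, rfl⟩ := exists_eval_length g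
  refine eval_mem_special fun a ha => ?_
  by_contra h'
  have := len_retr_eval_lt (Γ := Γ) ha h'
  omega

theorem len_retr_add_le {X Y : Set V} (hXY : Disjoint X Y) (g : RAAG Γ) :
    len (retr X g) + len (retr Y g) ≤ len g := by
  classical
  obtain ⟨w, hw, rfl⟩ := exists_eval_length g
  rw [← hw, retr_eval, retr_eval]
  refine (add_le_add (len_eval_le _) (len_eval_le _)).trans ?_
  clear hw
  induction w with
  | nil => simp
  | cons a w ih =>
    have : a.1 ∈ X → a.1 ∉ Y := fun h => Set.disjoint_left.1 hXY h
    by_cases h1 : a.1 ∈ X <;> by_cases h2 : a.1 ∈ Y <;> simp_all <;> omega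

/-- The vertices needed to express an element. -/
def supp (g : RAAG Γ) : Set V := {v | g ∉ special Γ {v}ᶜ}

theorem mem_special_supp (g : RAAG Γ) : g ∈ special Γ (supp g) := by
  obtain ⟨w, hw, rfl⟩ := exists_eval_length g
  exact eval_mem_special fun a ha hmem => fst_mem_of_geodesic hw hmem a ha rfl

theorem supp_subset {g : RAAG Γ} {S : Set V} (h : g ∈ special Γ S) : supp g ⊆ S := by
  intro v hv
  by_contra hvS
  exact hv (special_mono (fun x hx (hxv : x = v) => hvS (hxv ▸ hx)) h)

/-! ### Walls and the crossing cocycle -/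

/-- The walls: cosets of the subgroups generated by the link of a vertex. -/
abbrev Wall (Γ : SimpleGraph V) := Σ v : V, RAAG Γ ⧸ special Γ (Γ.neighborSet v)

/-- The wall dual to the edge from `g` to `g * gen v`. -/
def wallAt (v : V) (g : RAAG Γ) : Wall Γ := ⟨v, (g : RAAG Γ ⧸ special Γ (Γ.neighborSet v))⟩

theorem smul_wallAt (g h : RAAG Γ) (v : V) : g • wallAt v h = wallAt v (g * h) := rfl

theorem wallAt_eq_wallAt {v u : V} {g h : RAAG Γ} :
    wallAt v g = wallAt u h ↔ v = u ∧ g⁻¹ * h ∈ special Γ (Γ.neighborSet v) := by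
  constructor
  · intro e
    obtain rfl : v = u := congrArg Sigma.fst e
    exact ⟨rfl, QuotientGroup.eq.1 (eq_of_heq (Sigma.mk.inj_iff.1 e).2)⟩
  · rintro ⟨rfl, h⟩
    exact congrArg (Sigma.mk v) (QuotientGroup.eq.2 h)

open scoped Classical in
/-- The indicator function of a wall. -/
noncomputable def ind (a e : Wall Γ) : ℤ := if e = a then 1 else 0

@[simp] theorem ind_self (a : Wall Γ) : ind a a = 1 := if_pos rfl

theorem ind_of_ne {a e : Wall Γ} (h : e ≠ a) : ind a e = 0 := if_neg h

theorem ind_inv_smul (g : RAAG Γ) (a e : Wall Γ) : ind a (g⁻¹ • e) = ind (g • a) e := by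
  have h : g⁻¹ • e = a ↔ e = g • a := inv_smul_eq_iff
  by_cases h' : e = g • a
  · rw [h', inv_smul_smul, ind_self, ind_self]
  · rw [ind_of_ne h', ind_of_ne (mt h.1 h')]

theorem ind_smul (g : RAAG Γ) (a e : Wall Γ) : ind a (g • e) = ind (g⁻¹ • a) e := by
  rw [← ind_inv_smul, inv_inv]

/-- The affine permutation of integer functions on walls attached to a generator. -/
noncomputable def wallPerm (v : V) : Equiv.Perm (Wall Γ → ℤ) where
  toFun f e := f ((gen v : RAAG Γ)⁻¹ • e) + ind (wallAt v 1) e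
  invFun f e := f ((gen v : RAAG Γ) • e) - ind (wallAt v 1) ((gen v : RAAG Γ) • e)
  left_inv f := by ext e; simp
  right_inv f := by ext e; simp

theorem wallPerm_apply (v : V) (f : Wall Γ → ℤ) (e : Wall Γ) :
    wallPerm v f e = f ((gen v : RAAG Γ)⁻¹ • e) + ind (wallAt v 1) e := rfl

/-- The affine action on integer functions on walls. -/
noncomputable def affine : RAAG Γ →* Equiv.Perm (Wall Γ → ℤ) :=
  lift wallPerm (by
    have key : ∀ u w, Γ.Adj u w → (gen u : RAAG Γ) • wallAt (Γ := Γ) w 1 = wallAt w 1 := by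
      intro u w h
      rw [smul_wallAt, wallAt_eq_wallAt]
      exact ⟨rfl, by simpa using gen_mem_special (Γ := Γ) (S := Γ.neighborSet w) h.symm⟩
    intro u w h
    ext f e
    simp only [Equiv.Perm.mul_apply, wallPerm_apply, ind_inv_smul, key u w h, key w u h.symm,
      smul_smul, ← mul_inv_rev, (commute_gen h).eq]
    ring)

theorem affine_gen (v : V) : affine (gen v : RAAG Γ) = wallPerm v := lift_gen _ _ _

/-- The signed number of times a path from `1` to `g` crosses a wall. -/
noncomputable def crossing (g : RAAG Γ) : Wall Γ → ℤ := affine g 0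

theorem affine_apply (g : RAAG Γ) :
    ∀ f e, affine g f e = f (g⁻¹ • e) + crossing g e := by
  refine induction_gen (p := fun g => ∀ f e, affine g f e = f (g⁻¹ • e) + crossing g e)
    ?_ ?_ ?_ ?_ g
  · simp [crossing]
  · intro v f e
    simp [crossing, affine_gen, wallPerm_apply]
  · intro g h hg hh f e
    have : crossing (g * h) e = affine g (crossing h) e := by simp [crossing]
    rw [this, hg, map_mul, Equiv.Perm.mul_apply, hg, hh, mul_inv_rev, mul_smul]
    ring
  · intro g hg f e
    have h1 : ∀ f, affine g⁻¹ f e = f (g • e) - crossing g (g • e) := by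
      intro f
      have := hg (affine g⁻¹ f) (g • e)
      rw [← Equiv.Perm.mul_apply, ← map_mul] at this
      simp at this
      simp [this]
    have : crossing g⁻¹ e = affine g⁻¹ 0 e := rfl
    rw [this, h1, h1]
    simp
    ring

@[simp] theorem crossing_one : crossing (1 : RAAG Γ) = 0 := by
  simp [crossing]

theorem crossing_mul (g h : RAAG Γ) (e : Wall Γ) :
    crossing (g * h) e = crossing g e + crossing h (g⁻¹ • e) := by
  have : crossing (g * h) e = affine g (crossing h) e := by simp [crossing]
  rw [this, affine_apply, add_comm]

theorem crossing_gen (v : V) (e : Wall Γ) : crossing (gen v) e = ind (wallAt v 1) e := by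
  simp [crossing, affine_gen, wallPerm_apply]

theorem crossing_inv (g : RAAG Γ) (e : Wall Γ) : crossing g⁻¹ e = - crossing g (g • e) := by
  have := crossing_mul g⁻¹ g e
  simp at this
  linarith

theorem crossing_eq_zero {S : Set V} {g : RAAG Γ} (hg : g ∈ special Γ S) :
    ∀ e : Wall Γ, e.1 ∉ S → crossing g e = 0 := by
  refine special_induction (p := fun g => ∀ e : Wall Γ, e.1 ∉ S → crossing g e = 0) ?_ ?_ ?_ ?_ hg
  · simp
  · intro v hv e he
    rw [crossing_gen, ind_of_ne]
    rintro rfl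
    exact he hv
  · intro g h hg hh e he
    rw [crossing_mul, hg e he, hh (g⁻¹ • e) he, add_zero]
  · intro g hg e he
    rw [crossing_inv, hg (g • e) he, neg_zero]

/-- The positive endpoint convention for the edge of a letter read from `1`. -/
def start (a : V × Bool) : RAAG Γ := bif a.2 then 1 else (gen a.1)⁻¹

theorem crossing_letter (a : V × Bool) (e : Wall Γ) :
    crossing (letter a) e = (bif a.2 then 1 else -1) * ind (wallAt a.1 (start a)) e := by
  rcases a with ⟨v, _ | _⟩
  · simp [letter, start, crossing_inv, crossing_gen, ind_smul, smul_wallAt]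
  · simp [letter, start, crossing_gen]

/-! ### Paths -/

/-- The endpoint of the path of length `n` from `1` reading the letters of `x`. -/
def path (x : ℕ → V × Bool) : ℕ → RAAG Γ
  | 0 => 1
  | n + 1 => path x n * letter (x n)

@[simp] theorem path_zero (x : ℕ → V × Bool) : path x 0 = (1 : RAAG Γ) := rfl

theorem path_succ (x : ℕ → V × Bool) (n : ℕ) :
    (path x (n + 1) : RAAG Γ) = path x n * letter (x n) := rfl

theorem path_add (x : ℕ → V × Bool) (i k : ℕ) :
    (path x (i + k) : RAAG Γ) = path x i * path (fun n => x (i + n)) k := by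
  induction k with
  | zero => simp
  | succ k ih => rw [← add_assoc, path_succ, ih, path_succ, mul_assoc]

theorem path_eq_eval (x : ℕ → V × Bool) (n : ℕ) :
    (path x n : RAAG Γ) = eval ((List.range n).map x) := by
  induction n with
  | zero => rfl
  | succ n ih => rw [path_succ, ih, List.range_succ]; simp

theorem len_path_le (x : ℕ → V × Bool) (n : ℕ) : len (path x n : RAAG Γ) ≤ n := by
  rw [path_eq_eval]
  simpa using len_eval_le (Γ := Γ) ((List.range n).map x)

theorem exists_path [Nonempty V] (g : RAAG Γ) : ∃ x, path x (len g) = g := by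
  obtain ⟨w, hw, h⟩ := exists_eval_length g
  obtain ⟨v⟩ := ‹Nonempty V›
  refine ⟨fun n => w.getD n (v, true), ?_⟩
  rw [path_eq_eval, ← hw]
  conv_rhs => rw [← h]
  congr 1
  apply List.ext_getElem <;> simp +contextual

/-- The wall crossed by the step number `n` of a path. -/
def wall (Γ : SimpleGraph V) (x : ℕ → V × Bool) (n : ℕ) : Wall Γ :=
  wallAt (x n).1 (path x n * start (x n))

theorem wall_add (x : ℕ → V × Bool) (i k : ℕ) :
    wall Γ x (i + k) = (path x i : RAAG Γ) • wall Γ (fun n => x (i + n)) k := by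
  rw [wall, wall, smul_wallAt, path_add, mul_assoc]

theorem crossing_path (x : ℕ → V × Bool) (n : ℕ) (e : Wall Γ) :
    crossing (path x n) e =
      ∑ k ∈ Finset.range n, (bif (x k).2 then 1 else -1) * ind (wall Γ x k) e := by
  induction n with
  | zero => simp
  | succ n ih =>
    rw [path_succ, crossing_mul, ih, Finset.sum_range_succ, crossing_letter, ind_inv_smul,
      smul_wallAt, wall]

theorem exists_wall_of_crossing {x : ℕ → V × Bool} {n : ℕ} {e : Wall Γ}
    (h : crossing (path x n) e ≠ 0) : ∃ k < n, e = wall Γ x k := by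
  by_contra! h'
  refine h ?_
  rw [crossing_path]
  exact Finset.sum_eq_zero fun k hk => by rw [ind_of_ne (h' k (Finset.mem_range.1 hk)), mul_zero]

theorem crossing_wall {x : ℕ → V × Bool} {n : ℕ}
    (hx : ∀ i j, i < j → j < n → wall Γ x i ≠ wall Γ x j) {k : ℕ} (hk : k < n) :
    crossing (path x n) (wall Γ x k) ≠ 0 := by
  rw [crossing_path, Finset.sum_eq_single k]
  · cases (x k).2 <;> simp
  · intro j hj hjk
    rw [ind_of_ne, mul_zero]
    intro h
    rcases lt_or_gt_of_ne hjk with h' | h'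
    · exact hx j k h' hk h.symm
    · exact hx k j h' (Finset.mem_range.1 hj) h
  · intro h
    exact absurd (Finset.mem_range.2 hk) h

theorem finite_crossing (g : RAAG Γ) : {e | crossing g e ≠ 0}.Finite := by
  rcases isEmpty_or_nonempty V with hV | hV
  · exact Set.toFinite _
  · obtain ⟨x, hx⟩ := exists_path g
    refine ((Set.finite_Iio (len g)).image (wall Γ x)).subset ?_
    intro e he
    rw [← hx] at he
    obtain ⟨k, hk, rfl⟩ := exists_wall_of_crossing he
    exact ⟨k, hk, rfl⟩

/-! ### Geodesics and walls -/

theorem letter_mem_special (a : V × Bool) : letter a ∈ special Γ {a.1} := by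
  have := gen_mem_special (Γ := Γ) (S := {a.1}) rfl
  rcases a with ⟨v, _ | _⟩
  · exact inv_mem this
  · exact this

theorem start_mem_special (a : V × Bool) : start a ∈ special Γ {a.1} := by
  rcases a with ⟨v, _ | _⟩
  · exact letter_mem_special (v, false)
  · exact one_mem _

theorem path_congr {x y : ℕ → V × Bool} {n : ℕ} (h : ∀ k < n, x k = y k) :
    (path x n : RAAG Γ) = path y n := by
  rw [path_eq_eval, path_eq_eval]
  congr 1
  exact List.map_congr_left fun k hk => h k (List.mem_range.1 hk)

theorem fst_eq_of_wall_eq {x : ℕ → V × Bool} {i j : ℕ} (h : wall Γ x i = wall Γ x j) :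
    (x i).1 = (x j).1 :=
  (wallAt_eq_wallAt.1 h).1

theorem path_of_wall_eq {x : ℕ → V × Bool} {k : ℕ} (h : wall Γ x 0 = wall Γ x (k + 1)) :
    (path x (k + 1) : RAAG Γ) = retr (Γ.neighborSet (x 0).1) (path (fun n => x (n + 1)) k) *
      (start (x 0) * (start (x (k + 1)))⁻¹) := by
  obtain ⟨hv, hmem⟩ := wallAt_eq_wallAt.1 h
  have hd : Disjoint (Γ.neighborSet (x 0).1) {(x 0).1} := by simp
  have h0 := start_mem_special (Γ := Γ) (x 0)
  have h1 := start_mem_special (Γ := Γ) (x (k + 1))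
  rw [← hv] at h1
  have hp : (path x (k + 1) : RAAG Γ) = letter (x 0) * path (fun n => x (n + 1)) k := by
    rw [add_comm, path_add, path_succ, path_zero, one_mul]
    simp only [add_comm]
  set w : RAAG Γ := (path x 0 * start (x 0))⁻¹ * (path x (k + 1) * start (x (k + 1))) with hw
  have hr := retr_eq_self hmem
  rw [hw, hp] at hr
  simp only [map_mul, map_inv, retr_eq_one hd h0, retr_eq_one hd h1, path_zero, one_mul, inv_one,
    mul_one, retr_eq_one hd (letter_mem_special (x 0)), ← mul_assoc] at hr
  have hc : Commute (start (x 0)) w :=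
    commute_of_mem_special (by rintro _ rfl y hy; exact hy) h0 hmem
  have : retr (Γ.neighborSet (x 0).1) (path (fun n => x (n + 1)) k) = w := by
    rw [hr, hw, hp]
    simp only [path_zero, one_mul, mul_assoc]
  rw [this, ← mul_assoc, ← hc.eq, hw]
  simp [mul_assoc]

theorem len_start_mul_le {a b : V × Bool} (h : a.1 = b.1) :
    len (start a * ((start b)⁻¹ * letter b) : RAAG Γ) ≤ 1 := by
  rcases a with ⟨v, _ | _⟩ <;> rcases b with ⟨u, _ | _⟩ <;> obtain rfl : v = u := h <;>
    simp [start, letter]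
  · exact len_letter_le (v, false)
  · exact len_letter_le (v, true)

theorem start_mul_eq_one {a b : V × Bool} (h : a.1 = b.1) (hab : a ≠ b) :
    (start a * ((start b)⁻¹ * letter b) : RAAG Γ) = 1 := by
  rcases a with ⟨v, _ | _⟩ <;> rcases b with ⟨u, _ | _⟩ <;> obtain rfl : v = u := h <;>
    simp_all [start, letter]

theorem len_start_mul_start_le {a b : V × Bool} (h : a.1 = b.1) :
    len (start a * (start b)⁻¹ : RAAG Γ) ≤ 1 := by
  rcases a with ⟨v, _ | _⟩ <;> rcases b with ⟨u, _ | _⟩ <;> obtain rfl : v = u := h <;>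
    simp [start]
  · exact len_letter_le (v, false)
  · exact len_letter_le (v, true)

theorem len_retr_path_le (S : Set V) (x : ℕ → V × Bool) (n : ℕ) :
    len (retr S (path x n : RAAG Γ)) ≤ n :=
  (len_retr_le _ _).trans (len_path_le _ _)

theorem path_succ_of_wall_eq {x : ℕ → V × Bool} {k : ℕ} (h : wall Γ x 0 = wall Γ x (k + 1)) :
    (path x (k + 2) : RAAG Γ) = retr (Γ.neighborSet (x 0).1) (path (fun n => x (n + 1)) k) *
      (start (x 0) * ((start (x (k + 1)))⁻¹ * letter (x (k + 1)))) := by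
  rw [path_succ, path_of_wall_eq h]
  simp only [mul_assoc]

theorem wall_shift_eq {x : ℕ → V × Bool} {i a b : ℕ} :
    wall Γ (fun n => x (i + n)) a = wall Γ (fun n => x (i + n)) b ↔
      wall Γ x (i + a) = wall Γ x (i + b) := by
  rw [wall_add, wall_add, smul_left_cancel_iff]

theorem wall_ne_of_geodesic {x : ℕ → V × Bool} {n : ℕ} (hn : n ≤ len (path x n : RAAG Γ)) :
    ∀ i j, i < j → j < n → wall Γ x i ≠ wall Γ x j := by
  intro i j hij hjn h
  obtain ⟨k, rfl⟩ : ∃ k, j = i + (k + 1) := ⟨j - i - 1, by omega⟩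
  obtain ⟨r, rfl⟩ : ∃ r, n = i + (k + 2 + r) := ⟨n - i - k - 2, by omega⟩
  have h' := wall_shift_eq.2 (show wall Γ x (i + 0) = _ from h)
  rw [path_add, path_add, path_succ_of_wall_eq h'] at hn
  have h1 := len_path_le (Γ := Γ) x i
  have h2 := len_retr_path_le (Γ := Γ) (Γ.neighborSet (x (i + 0)).1) (fun n => x (i + (n + 1))) k
  have h3 := len_start_mul_le (Γ := Γ) (fst_eq_of_wall_eq h')
  have h4 := len_path_le (Γ := Γ) (fun n => x (i + (k + 2 + n))) r
  have h5 := hn.trans (len_mul_le _ _)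
  have h6 := h5.trans (Nat.add_le_add_left
    ((len_mul_le _ _).trans (Nat.add_le_add_right (len_mul_le _ _) _)) _)
  omega

theorem len_path_of_wall_ne {x : ℕ → V × Bool} {n : ℕ}
    (hx : ∀ i j, i < j → j < n → wall Γ x i ≠ wall Γ x j) : len (path x n : RAAG Γ) = n := by
  classical
  refine le_antisymm (len_path_le x n) ?_
  have : Nonempty V := ⟨(x 0).1⟩
  obtain ⟨y, hy⟩ := exists_path (path x n : RAAG Γ)
  have hsub : (Finset.range n).image (wall Γ x) ⊆
      (Finset.range (len (path x n : RAAG Γ))).image (wall Γ y) := by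
    intro e he
    obtain ⟨k, hk, rfl⟩ := Finset.mem_image.1 he
    have hc := crossing_wall hx (Finset.mem_range.1 hk)
    rw [← hy] at hc
    obtain ⟨j, hj, h⟩ := exists_wall_of_crossing hc
    exact Finset.mem_image.2 ⟨j, Finset.mem_range.2 hj, h.symm⟩
  have hcard := (Finset.card_le_card hsub).trans Finset.card_image_le
  rw [Finset.card_range, Finset.card_image_of_injOn, Finset.card_range] at hcard
  · exact hcard
  · intro i hi j hj h
    simp only [Finset.coe_range, Set.mem_Iio] at hi hj
    by_contra hij
    rcases lt_or_gt_of_ne hij with h' | h'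
    · exact hx i j h' hj h
    · exact hx j i h' hi h.symm

theorem exists_crossing {g : RAAG Γ} {v : V} (hv : v ∈ supp g) :
    ∃ h, crossing g (wallAt v h) ≠ 0 := by
  have : Nonempty V := ⟨v⟩
  obtain ⟨x, hx⟩ := exists_path g
  by_contra! hc
  refine hv ?_
  rw [← hx, path_eq_eval]
  refine eval_mem_special fun a ha hav => ?_
  obtain ⟨k, hk, rfl⟩ := List.mem_map.1 ha
  have hne := crossing_wall (wall_ne_of_geodesic (n := len g) (by rw [hx]))
    (List.mem_range.1 hk)
  rw [hx] at hne
  obtain rfl : (x k).1 = v := hav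
  exact hne (hc _)

/-! ### Straight elements -/

/-- An element whose powers have the largest conceivable length. -/
def Straight (c : RAAG Γ) : Prop := ∀ n, len (c ^ n) = n * len c

theorem add_mul_of_periodic {x : ℕ → V × Bool} {L : ℕ} (hx : ∀ m, x (m + L) = x m) (n m : ℕ) :
    x (n * L + m) = x m := by
  induction n with
  | zero => simp
  | succ n ih => rw [show (n + 1) * L + m = n * L + m + L by ring, hx, ih]

theorem path_mul_of_periodic {x : ℕ → V × Bool} {L : ℕ} (hx : ∀ m, x (m + L) = x m) (n : ℕ) :
    (path x (n * L) : RAAG Γ) = path x L ^ n := by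
  induction n with
  | zero => simp
  | succ n ih =>
    rw [add_mul, one_mul, path_add, ih, pow_succ]
    simp only [add_mul_of_periodic hx]

theorem wall_ne_of_periodic {x : ℕ → V × Bool} {L : ℕ} (hL : 0 < L) (hx : ∀ m, x (m + L) = x m)
    (hmin : ∀ g, L ≤ len (g⁻¹ * path x L * g : RAAG Γ)) :
    ∀ i j, i < j → wall Γ x i ≠ wall Γ x j := by
  classical
  by_contra! hcon
  have hex : ∃ d, ∃ i, wall Γ x i = wall Γ x (i + (d + 1)) := by
    obtain ⟨i, j, hij, h⟩ := hcon
    exact ⟨j - i - 1, i, by rw [h]; congr 1; omega⟩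
  obtain ⟨i, hi⟩ := Nat.find_spec hex
  have hd : ∀ a b, a < b → b < a + (Nat.find hex + 1) → wall Γ x a ≠ wall Γ x b := by
    intro a b hab hb h
    refine Nat.find_min hex (m := b - a - 1) (by omega) ⟨a, ?_⟩
    rw [h]; congr 1; omega
  generalize Nat.find hex = d at hi hd
  have hy0 : ∀ m, x (i + (m + L)) = x (i + m) := fun m => by rw [← add_assoc, hx]
  have hconj : (path (fun n => x (i + n)) L : RAAG Γ) = (path x i)⁻¹ * path x L * path x i := by
    have h1 := path_add (Γ := Γ) x i L
    have h2 := path_add (Γ := Γ) x L i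
    simp only [add_comm L, hx] at h2
    rw [mul_assoc, ← h2, h1, inv_mul_cancel_left]
  have hlen := hmin (path x i)
  rw [← hconj] at hlen
  clear hconj hmin hcon hex
  have hwall := wall_shift_eq.2 (show wall Γ x (i + 0) = _ from hi)
  have hgeo : len (path (fun n => x (i + n)) (d + 1) : RAAG Γ) = d + 1 :=
    len_path_of_wall_ne fun a b hab hb h => hd _ _ (by omega) (by omega) (wall_shift_eq.1 h)
  generalize hy : (fun n => x (i + n)) = y at hlen hwall hgeo
  have hv := fst_eq_of_wall_eq hwall
  have hp := path_of_wall_eq hwall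
  have hp2 := path_succ_of_wall_eq hwall
  have hyL : ∀ m, y (m + L) = y m := by rw [← hy]; exact hy0
  clear hy hy0 hx hd hi
  have hw := len_retr_path_le (Γ := Γ) (Γ.neighborSet (y 0).1) (fun n => y (n + 1)) d
  have hne : y 0 ≠ y (d + 1) := by
    intro h
    rw [hp, h, mul_inv_cancel, mul_one, ← h] at hgeo
    omega
  rcases lt_trichotomy (d + 1) L with h | h | h
  · obtain ⟨r, rfl⟩ : ∃ r, L = d + 2 + r := ⟨L - d - 2, by omega⟩
    rw [path_add, hp2, start_mul_eq_one hv hne, mul_one] at hlen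
    have h1 := len_path_le (Γ := Γ) (fun n => y (d + 2 + n)) r
    have := hlen.trans (len_mul_le _ _)
    omega
  · exact hne (by rw [h, ← hyL 0, zero_add])
  · have hlt : len (retr (Γ.neighborSet (y 0).1) (path (fun n => y (n + 1)) d : RAAG Γ)) < d := by
      rw [path_eq_eval]
      refine (len_retr_eval_lt (a := y L) (List.mem_map.2 ⟨L - 1, ?_, ?_⟩) ?_).trans_le (by simp)
      · rw [List.mem_range]; omega
      · congr 1; omega
      · have := hyL 0
        rw [zero_add] at this
        simp [this]
    rw [hp] at hgeo
    have h1 := len_start_mul_start_le (Γ := Γ) hv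
    have := hgeo.symm.le.trans (len_mul_le _ _)
    omega

theorem exists_periodic [Nonempty V] (c : RAAG Γ) :
    ∃ x, (∀ m, x (m + len c) = x m) ∧ path x (len c) = c := by
  obtain ⟨x, hx⟩ := exists_path c
  refine ⟨fun n => x (n % len c), fun m => by simp, ?_⟩
  conv_rhs => rw [← hx]
  exact path_congr fun k hk => by simp [Nat.mod_eq_of_lt hk]

theorem straight_one : Straight (1 : RAAG Γ) := fun n => by simp

theorem exists_straight (c : RAAG Γ) : ∃ g, Straight (g⁻¹ * c * g) := by
  rcases isEmpty_or_nonempty V with hV | hV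
  · refine ⟨1, ?_⟩
    have : c = 1 := eq_one_of_len_eq_zero (by
      obtain ⟨w, hw, -⟩ := exists_eval_length c
      rw [← hw, List.length_eq_zero_iff]
      cases w with
      | nil => rfl
      | cons a _ => exact hV.elim a.1)
    simpa [this] using straight_one
  · set g := Function.argmin (fun g => len (g⁻¹ * c * g)) with hg
    have hmin : ∀ h, len (g⁻¹ * c * g) ≤ len (h⁻¹ * c * h) := fun h =>
      Function.argmin_le (fun g => len (g⁻¹ * c * g)) h
    refine ⟨g, ?_⟩
    rcases Nat.eq_zero_or_pos (len (g⁻¹ * c * g)) with h0 | h0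
    · rw [eq_one_of_len_eq_zero h0]; exact straight_one
    · obtain ⟨x, hx, hxc⟩ := exists_periodic (g⁻¹ * c * g)
      intro n
      conv_lhs => rw [← hxc, ← path_mul_of_periodic hx]
      refine len_path_of_wall_ne fun i j hij _ => wall_ne_of_periodic h0 hx (fun h => ?_) i j hij
      rw [hxc]
      refine (hmin (g * h)).trans_eq ?_
      simp only [mul_inv_rev, mul_assoc]

theorem Straight.pow {c : RAAG Γ} (hc : Straight c) (k : ℕ) : Straight (c ^ k) := fun n => by
  rw [← pow_mul, hc, hc, mul_comm k n, mul_assoc]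

theorem Straight.crossing_pow_smul {c : RAAG Γ} (hc : Straight c) {e : Wall Γ}
    (he : crossing c e ≠ 0) {n : ℕ} (hn : n ≠ 0) : crossing c (c ^ n • e) = 0 := by
  have : Nonempty V := ⟨e.1⟩
  have hL : 0 < len c := by
    by_contra h
    rw [eq_one_of_len_eq_zero (g := c) (by omega)] at he
    simp at he
  obtain ⟨x, hx, hxc⟩ := exists_periodic c
  have hne : ∀ i j, i < j → wall Γ x i ≠ wall Γ x j := by
    intro i j hij
    refine wall_ne_of_geodesic (n := (j + 1) * len c) ?_ i j hij ?_
    · rw [path_mul_of_periodic hx, hxc, hc]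
    · nlinarith
  by_contra he'
  rw [← hxc] at he he'
  obtain ⟨j, hj, rfl⟩ := exists_wall_of_crossing he
  obtain ⟨j', hj', h⟩ := exists_wall_of_crossing he'
  have h2 := wall_add (Γ := Γ) x (n * len c) j
  simp only [add_mul_of_periodic hx] at h2
  rw [path_mul_of_periodic hx, h] at h2
  refine hne j' (n * len c + j) ?_ h2.symm
  have : len c ≤ n * len c := Nat.le_mul_of_pos_left _ (Nat.pos_of_ne_zero hn)
  omega

theorem Straight.crossing_zpow_smul {c : RAAG Γ} (hc : Straight c) {e : Wall Γ}
    (he : crossing c e ≠ 0) {n : ℤ} (hn : n ≠ 0) : crossing c (c ^ n • e) = 0 := by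
  obtain ⟨m, rfl | rfl⟩ := n.eq_nat_or_neg
  · rw [zpow_natCast]
    exact hc.crossing_pow_smul he (by simpa using hn)
  · by_contra h
    have := hc.crossing_pow_smul h (n := m) (by simpa using hn)
    rw [smul_smul, zpow_neg, zpow_natCast, mul_inv_cancel, one_smul] at this
    exact he this

theorem Straight.zpow_smul_ne {c : RAAG Γ} (hc : Straight c) {e : Wall Γ}
    (he : crossing c e ≠ 0) {n : ℤ} (hn : n ≠ 0) : c ^ n • e ≠ e := fun h => by
  have := hc.crossing_zpow_smul he hn
  rw [h] at this
  exact he this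

theorem Straight.mem_special_of_conj_pow {c g : RAAG Γ} (hc : Straight c) {m : ℕ} (hm : 0 < m)
    {T : Set V} (h : g⁻¹ * c ^ m * g ∈ special Γ T) : c ∈ special Γ T := by
  refine mem_special_of_len_le ?_
  by_contra! hlt
  have key : ∀ n, m * n * len c ≤ len g + len g⁻¹ + len (retr T g) + len (retr T g)⁻¹ +
      m * n * len (retr T c) := by
    intro n
    have h1 : c ^ (m * n) = g * (g⁻¹ * c ^ m * g) ^ n * g⁻¹ := by
      have := conj_pow (i := n) (a := g⁻¹) (b := c ^ m)
      rw [inv_inv] at this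
      rw [this, pow_mul]
      group
    have h2 : (g⁻¹ * c ^ m * g) ^ n = (retr T g)⁻¹ * retr T c ^ (m * n) * retr T g := by
      rw [← retr_eq_self (pow_mem h n)]
      have := conj_pow (i := n) (a := (retr T g)⁻¹) (b := retr T c ^ m)
      rw [inv_inv] at this
      simp only [map_pow, map_mul, map_inv, pow_mul]
      exact this
    rw [← hc, h1, h2]
    have h3 := len_mul_le (g * ((retr T g)⁻¹ * retr T c ^ (m * n) * retr T g)) g⁻¹
    have h4 := len_mul_le g ((retr T g)⁻¹ * retr T c ^ (m * n) * retr T g)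
    have h5 := len_mul_le ((retr T g)⁻¹ * retr T c ^ (m * n)) (retr T g)
    have h6 := len_mul_le (retr T g)⁻¹ (retr T c ^ (m * n))
    have h7 := len_pow_le (retr T c) (m * n)
    omega
  have h1 := key (len g + len g⁻¹ + len (retr T g) + len (retr T g)⁻¹ + 1)
  generalize len g + len g⁻¹ + len (retr T g) + len (retr T g)⁻¹ = C at h1
  have : C + 1 ≤ m * (C + 1) := Nat.le_mul_of_pos_left _ hm
  nlinarith

theorem exists_pow_smul_eq {S : Set (Wall Γ)} (hS : S.Finite) {c : RAAG Γ} {e : Wall Γ}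
    (h : ∀ n : ℕ, c ^ n • e ∈ S) : ∃ m, 0 < m ∧ c ^ m • e = e := by
  have := hS.to_subtype
  obtain ⟨a, b, hab, heq⟩ := Finite.exists_ne_map_eq_of_infinite (fun n => (⟨_, h n⟩ : S))
  have key : ∀ a b : ℕ, a < b → c ^ a • e = c ^ b • e → ∃ m, 0 < m ∧ c ^ m • e = e := by
    intro a b hab h
    refine ⟨b - a, by omega, ?_⟩
    rw [← smul_left_cancel_iff (c ^ a), smul_smul, ← pow_add, h]
    congr 2; omega
  rcases lt_or_gt_of_ne hab with h' | h'
  · exact key a b h' (Subtype.mk.inj heq)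
  · exact key b a h' (Subtype.mk.inj heq).symm

theorem Straight.mem_supp_or_adj {c g : RAAG Γ} (hc : Straight c) (hgc : Commute g c) {u : V}
    (hu : u ∈ supp g) : u ∈ supp c ∨ ∀ s ∈ supp c, Γ.Adj u s := by
  by_cases huc : u ∈ supp c
  · exact Or.inl huc
  right
  obtain ⟨h, hh⟩ := exists_crossing hu
  have hinv : ∀ e : Wall Γ, e.1 = u → crossing g (c • e) = crossing g e := by
    intro e he
    have h0 : ∀ e : Wall Γ, e.1 = u → crossing c e = 0 := fun e he =>
      crossing_eq_zero (mem_special_supp c) e (he ▸ huc)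
    have h1 := crossing_mul g c (c • e)
    have h2 := crossing_mul c g (c • e)
    rw [h0 (g⁻¹ • c • e) he, add_zero] at h1
    rw [h0 (c • e) he, zero_add, inv_smul_smul] at h2
    rw [← h1, ← h2, hgc.eq]
  have hpow : ∀ n : ℕ, crossing g (c ^ n • wallAt u h) ≠ 0 := by
    intro n
    induction n with
    | zero => simpa using hh
    | succ n ih => rw [pow_succ', mul_smul, hinv _ rfl]; exact ih
  obtain ⟨m, hm, h1⟩ := exists_pow_smul_eq (finite_crossing g) hpow
  rw [smul_wallAt] at h1
  have h2 := (wallAt_eq_wallAt.1 h1.symm).2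
  rw [← mul_assoc] at h2
  exact fun s hs => supp_subset (hc.mem_special_of_conj_pow hm h2) hs

/-! ### Joins and supports -/

theorem retr_retr {X T : Set V} (h : X ⊆ T) (g : RAAG Γ) : retr X (retr T g) = retr X g := by
  refine induction_gen (p := fun g => retr X (retr T g) = retr X g) (by simp) (fun v => ?_)
    (fun g h hg hh => by simp only [map_mul, hg, hh]) (fun g hg => by simp only [map_inv, hg]) g
  by_cases hv : v ∈ T
  · rw [retr_gen_of_mem hv]
  · rw [retr_gen_of_notMem hv, map_one, retr_gen_of_notMem fun h' => hv (h h')]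

theorem mem_supp_of_retr {X : Set V} {g : RAAG Γ} {v : V} (h : v ∈ supp (retr X g)) :
    v ∈ supp g := by
  intro h'
  exact h (special_mono Set.inter_subset_right (retr_mem_inter (S := X) h'))

theorem len_mul_of_join {X Y : Set V} (hXY : ∀ x ∈ X, ∀ y ∈ Y, Γ.Adj x y) {a b : RAAG Γ}
    (ha : a ∈ special Γ X) (hb : b ∈ special Γ Y) : len (a * b) = len a + len b := by
  have hd := disjoint_of_join hXY
  refine le_antisymm (len_mul_le a b) ?_
  have := len_retr_add_le hd (a * b)
  rwa [map_mul, map_mul, retr_eq_self ha, retr_eq_self hb, retr_eq_one hd hb,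
    retr_eq_one hd.symm ha, mul_one, one_mul] at this

theorem straight_mul_iff {X Y : Set V} (hXY : ∀ x ∈ X, ∀ y ∈ Y, Γ.Adj x y) {a b : RAAG Γ}
    (ha : a ∈ special Γ X) (hb : b ∈ special Γ Y) :
    Straight (a * b) ↔ Straight a ∧ Straight b := by
  have hc := commute_of_mem_special hXY ha hb
  have key : ∀ n, len ((a * b) ^ n) = len (a ^ n) + len (b ^ n) := fun n => by
    rw [hc.mul_pow, len_mul_of_join hXY (pow_mem ha n) (pow_mem hb n)]
  have key1 := len_mul_of_join hXY ha hb
  constructor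
  · intro h
    have h' : ∀ n, len (a ^ n) = n * len a ∧ len (b ^ n) = n * len b := by
      intro n
      have h1 := h n
      rw [key, key1, mul_add] at h1
      have := len_pow_le a n
      have := len_pow_le b n
      omega
    exact ⟨fun n => (h' n).1, fun n => (h' n).2⟩
  · rintro ⟨h1, h2⟩ n
    rw [key, key1, h1, h2, mul_add]

/-- The vertices adjacent to every vertex of `S`. -/
def perp (Γ : SimpleGraph V) (S : Set V) : Set V := {u | ∀ s ∈ S, Γ.Adj u s}

theorem Straight.mem_special_of_commute {c g : RAAG Γ} (hc : Straight c) (hgc : Commute g c) :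
    g ∈ special Γ (supp c ∪ perp Γ (supp c)) :=
  special_mono (fun _ hu => hc.mem_supp_or_adj hgc hu) (mem_special_supp g)

theorem commute_of_retr_eq {X Y : Set V} (hXY : ∀ x ∈ X, ∀ y ∈ Y, Γ.Adj x y) {a d e : RAAG Γ}
    (ha : Straight a) (hX : X ⊆ supp a) (hd : d ∈ special Γ (X ∪ Y)) (had : retr X d = a)
    (hed : Commute e d) : Commute e a := by
  have haX : a ∈ special Γ X := had ▸ retr_mem X d
  obtain ⟨h, hh⟩ := exists_straight (retr Y d)
  have hmem : h⁻¹ * retr Y d * h ∈ special Γ Y := by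
    refine hh.mem_special_of_conj_pow (m := 1) (g := h⁻¹) one_pos ?_
    simpa [mul_assoc] using retr_mem Y d
  have hr := retr_eq_self hmem
  rw [map_mul, map_mul, map_inv, retr_retr le_rfl] at hr
  set b := retr Y h with hb
  set r := h⁻¹ * retr Y d * h with hrdef
  have hab : Commute a b := commute_of_mem_special hXY haX (retr_mem Y h)
  have hd' : b⁻¹ * d * b = a * r := by
    conv_lhs => rw [eq_retr_mul_retr hXY hd, had]
    rw [← hr, ← mul_assoc, ← hab.inv_right.eq]
    simp only [mul_assoc]
  have hst : Straight (a * r) := (straight_mul_iff hXY haX hmem).2 ⟨ha, hh⟩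
  have hretr : retr X (a * r) = a := by
    rw [map_mul, retr_eq_self haX, retr_eq_one (disjoint_of_join hXY) hmem, mul_one]
  have hXD : X ⊆ supp (a * r) := fun x hx => mem_supp_of_retr (X := X) (by rw [hretr]; exact hX hx)
  have hDXY : supp (a * r) ⊆ X ∪ Y :=
    supp_subset (mul_mem (special_mono Set.subset_union_left haX)
      (special_mono Set.subset_union_right hmem))
  set D := supp (a * r) with hD
  have hjoin : ∀ x ∈ X, ∀ y ∈ (D \ X) ∪ perp Γ D, Γ.Adj x y := by
    rintro x hx y (⟨hyD, hyX⟩ | hy)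
    · exact hXY x hx y ((hDXY hyD).resolve_left hyX)
    · exact (hy x (hXD hx)).symm
  have hcomm : Commute (b⁻¹ * e * b) (a * r) := by
    rw [← hd']
    have := (Commute.conj_iff b⁻¹).2 hed
    rwa [inv_inv] at this
  have hmem' : b⁻¹ * e * b ∈ special Γ (X ∪ ((D \ X) ∪ perp Γ D)) := by
    refine special_mono ?_ (hst.mem_special_of_commute hcomm)
    rintro u (hu | hu)
    · by_cases huX : u ∈ X
      · exact Or.inl huX
      · exact Or.inr (Or.inl ⟨hu, huX⟩)
    · exact Or.inr (Or.inr hu)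
  have h1 : Commute (b⁻¹ * e * b) a := by
    rw [eq_retr_mul_retr hjoin hmem']
    refine Commute.mul_left ?_ (commute_of_mem_special hjoin haX (retr_mem _ _)).symm
    have := hcomm.map (retr X)
    rwa [hretr] at this
  have h2 := (Commute.conj_iff b).2 h1
  rwa [← hab.eq, mul_inv_cancel_right, show b * (b⁻¹ * e * b) * b⁻¹ = e by group] at h2

/-- The component of `v` in the complement of the graph induced on `S`. -/
def coComponent (Γ : SimpleGraph V) (S : Set V) (v : V) : Set V :=
  {u | Relation.ReflTransGen (fun a b => b ∈ S ∧ ¬ Γ.Adj a b) v u}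

theorem self_mem_coComponent (S : Set V) (v : V) : v ∈ coComponent Γ S v :=
  Relation.ReflTransGen.refl

theorem mem_coComponent_of_not_adj {S : Set V} {v a b : V} (ha : a ∈ coComponent Γ S v)
    (hb : b ∈ S) (hab : ¬ Γ.Adj a b) : b ∈ coComponent Γ S v :=
  Relation.ReflTransGen.tail ha ⟨hb, hab⟩

theorem coComponent_subset {S T : Set V} {v : V} (hv : v ∈ T)
    (hT : ∀ a ∈ T, ∀ b ∈ S, ¬ Γ.Adj a b → b ∈ T) : coComponent Γ S v ⊆ T := by
  intro u hu
  induction hu with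
  | refl => exact hv
  | tail _ h ih => exact hT _ ih _ h.1 h.2

theorem coComponent_join {S : Set V} {v : V} (hv : v ∈ S) :
    ∀ x ∈ coComponent Γ S v, ∀ y ∈ (S \ coComponent Γ S v) ∪ perp Γ S, Γ.Adj x y := by
  rintro x hx y (⟨hy, hyX⟩ | hy)
  · by_contra h
    exact hyX (mem_coComponent_of_not_adj hx hy h)
  · exact (hy x (coComponent_subset hv (fun _ _ b hb _ => hb) hx)).symm

theorem union_perp_subset (S X : Set V) : S ∪ perp Γ S ⊆ X ∪ ((S \ X) ∪ perp Γ S) := by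
  rintro u (hu | hu)
  · by_cases huX : u ∈ X
    · exact Or.inl huX
    · exact Or.inr (Or.inl ⟨hu, huX⟩)
  · exact Or.inr (Or.inr hu)

/-- The component of `c` supported on the co-component of `v` in its support. -/
noncomputable def part (c : RAAG Γ) (v : V) : RAAG Γ := retr (coComponent Γ (supp c) v) c

theorem Straight.mem_special_join {c g : RAAG Γ} (hc : Straight c) (v : V) (hgc : Commute g c) :
    g ∈ special Γ (coComponent Γ (supp c) v ∪
      ((supp c \ coComponent Γ (supp c) v) ∪ perp Γ (supp c))) :=
  special_mono (union_perp_subset _ _) (hc.mem_special_of_commute hgc)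

theorem Straight.commute_part {c g : RAAG Γ} (hc : Straight c) {v : V} (hv : v ∈ supp c)
    (hgc : Commute g c) : Commute g (part c v) := by
  have hj := coComponent_join (Γ := Γ) hv
  rw [eq_retr_mul_retr hj (hc.mem_special_join v hgc)]
  exact (hgc.map _).mul_left (commute_of_mem_special hj (retr_mem _ _) (retr_mem _ _)).symm

theorem straight_part {c : RAAG Γ} (hc : Straight c) {v : V} (hv : v ∈ supp c) :
    Straight (part c v) := by
  have hj := coComponent_join (Γ := Γ) hv
  have h := eq_retr_mul_retr hj (hc.mem_special_join v (Commute.refl c))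
  have hc' := hc
  rw [h] at hc'
  exact ((straight_mul_iff hj (retr_mem _ _) (retr_mem _ _)).1 hc').1

theorem Straight.coComponent_subset_supp {c : RAAG Γ} (hc : Straight c) {v : V} (hv : v ∈ supp c)
    {q : ℕ} (hq : 0 < q) : coComponent Γ (supp c) v ⊆ supp (part c v ^ q) := by
  intro x hx hmem
  have hj := coComponent_join (Γ := Γ) hv
  have h1 : part c v ∈ special Γ {x}ᶜ :=
    (straight_part hc hv).mem_special_of_conj_pow (g := 1) hq (by simpa using hmem)
  have h2 := eq_retr_mul_retr hj (hc.mem_special_join v (Commute.refl c))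
  have hxS : x ∈ supp c := coComponent_subset hv (fun _ _ b hb _ => hb) hx
  refine hxS ?_
  rw [h2]
  refine mul_mem h1 (special_mono ?_ (retr_mem _ _))
  rintro y hy rfl
  exact Γ.irrefl (hj y hx y hy)

theorem pow_mem_closure_part [Finite V] (c : RAAG Γ) (N : ℕ) :
    c ^ N ∈ Subgroup.closure ((fun v => part c v ^ N) '' supp c) := by
  have key : ∀ n, ∀ T : Set V, T.ncard = n → T ⊆ supp c →
      (∀ a ∈ T, ∀ b ∈ supp c, ¬ Γ.Adj a b → b ∈ T) →
      retr T c ^ N ∈ Subgroup.closure ((fun v => part c v ^ N) '' supp c) := by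
    intro n
    induction n using Nat.strong_induction_on with
    | _ n ih =>
      intro T hn hTS hT
      rcases T.eq_empty_or_nonempty with rfl | ⟨v, hv⟩
      · have := retr_mem ∅ c
        rw [special, Set.image_empty, Subgroup.closure_empty, Subgroup.mem_bot] at this
        rw [this, one_pow]
        exact one_mem _
      · set X := coComponent Γ (supp c) v with hX
        have hXT : X ⊆ T := coComponent_subset hv hT
        have hj : ∀ x ∈ X, ∀ y ∈ T \ X, Γ.Adj x y := fun x hx y hy =>
          coComponent_join (hTS hv) x hx y (Or.inl ⟨hTS hy.1, hy.2⟩)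
        have hmem : retr T c ∈ special Γ (X ∪ T \ X) := by
          rw [Set.union_sdiff_cancel hXT]
          exact retr_mem T c
        rw [eq_retr_mul_retr hj hmem, retr_retr hXT, retr_retr Set.sdiff_subset,
          (commute_of_mem_special hj (retr_mem _ _) (retr_mem _ _)).mul_pow]
        refine mul_mem (Subgroup.subset_closure ⟨v, hTS hv, rfl⟩)
          (ih _ ?_ _ rfl (Set.sdiff_subset.trans hTS) ?_)
        · rw [← hn]
          exact Set.ncard_lt_ncard ⟨Set.sdiff_subset, fun h =>
            (h hv).2 (self_mem_coComponent _ _)⟩ (Set.toFinite T)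
        · rintro a ⟨haT, haX⟩ b hb hab
          exact ⟨hT a haT b hb hab, fun hbX =>
            haX (mem_coComponent_of_not_adj hbX (hTS haT) fun h => hab h.symm)⟩
  have := key _ (supp c) rfl le_rfl fun _ _ b hb _ => hb
  rwa [retr_eq_self (mem_special_supp c)] at this

/-! ### Translation along a wall orbit -/

theorem Straight.retr_eq_zpow {c d g : RAAG Γ} (hc : Straight c) {v : V} (hv : v ∈ supp c)
    (hdc : Commute d c) {q : ℤ} (hd : d • wallAt v g = c ^ q • wallAt v g) :
    retr (coComponent Γ (supp c) v) d = part c v ^ q := by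
  set t := c ^ (-q) * d with ht
  have htc : Commute c t := ((Commute.refl c).zpow_right (-q)).mul_right hdc.symm
  have hfix : t • wallAt v g = wallAt v g := by
    rw [ht, mul_smul, hd, smul_smul, ← zpow_add, neg_add_cancel, zpow_zero, one_smul]
  rw [smul_wallAt] at hfix
  have hτ := (wallAt_eq_wallAt.1 hfix.symm).2
  obtain ⟨h, hst⟩ := exists_straight t
  have hT : supp (h⁻¹ * t * h) ⊆ Γ.neighborSet v := by
    refine supp_subset (hst.mem_special_of_conj_pow (m := 1) (g := h⁻¹ * g) one_pos ?_)
    convert hτ using 1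
    group
  set T := supp (h⁻¹ * t * h) with hTdef
  have hcomm : Commute (h⁻¹ * c * h) (h⁻¹ * t * h) := by
    have := (Commute.conj_iff h⁻¹).2 htc
    rwa [inv_inv] at this
  have hS : supp c ⊆ T ∪ perp Γ T := by
    refine supp_subset (hc.mem_special_of_conj_pow (m := 1) (g := h) one_pos ?_)
    rw [pow_one]
    exact hst.mem_special_of_commute hcomm
  have hX : coComponent Γ (supp c) v ⊆ perp Γ T := by
    refine coComponent_subset ((hS hv).resolve_left fun h => Γ.irrefl (hT h)) ?_
    exact fun a ha b hb hab => (hS hb).resolve_left fun h => hab (ha b h)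
  have hdisj : Disjoint (coComponent Γ (supp c) v) T :=
    Set.disjoint_left.2 fun a ha haT => Γ.irrefl (hX ha a haT)
  have h1 := retr_eq_one hdisj (mem_special_supp (h⁻¹ * t * h))
  have h2 : retr (coComponent Γ (supp c) v) t = 1 := by
    rw [map_mul, map_mul, map_inv, mul_assoc, inv_mul_eq_one] at h1
    simpa using h1.symm
  rw [ht, map_mul, map_zpow, zpow_neg, inv_mul_eq_one] at h2
  exact h2.symm

theorem Straight.exists_commute_pow {c d e g : RAAG Γ} (hc : Straight c) {v : V}
    (hv : v ∈ supp c) (hdc : Commute d c) {q : ℤ} (hq : q ≠ 0)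
    (hd : d • wallAt v g = c ^ q • wallAt v g) (hed : Commute e d) :
    ∃ p : ℕ, 0 < p ∧ Commute e (part c v ^ p) := by
  have key : ∀ d : RAAG Γ, ∀ p : ℕ, 0 < p → Commute d c → Commute e d →
      retr (coComponent Γ (supp c) v) d = part c v ^ p → Commute e (part c v ^ p) :=
    fun d p hp hdc hed hr => commute_of_retr_eq (coComponent_join hv) ((straight_part hc hv).pow p)
      (hc.coComponent_subset_supp hv hp) (hc.mem_special_join v hdc) hr hed
  have hr := hc.retr_eq_zpow hv hdc hd
  obtain ⟨p, rfl | rfl⟩ := q.eq_nat_or_neg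
  · have hp : 0 < p := Nat.pos_of_ne_zero (by simpa using hq)
    exact ⟨p, hp, key d p hp hdc hed (by rw [hr, zpow_natCast])⟩
  · have hp : 0 < p := Nat.pos_of_ne_zero (by simpa using hq)
    exact ⟨p, hp, key d⁻¹ p hp hdc.inv_left hed.inv_right
      (by rw [map_inv, hr, zpow_neg, inv_inv, zpow_natCast])⟩

/-- The elements of the centralizer of `c` translating the wall `e` within its `c`-orbit. -/
def translators (c : RAAG Γ) (e : Wall Γ) : Subgroup (RAAG Γ) where
  carrier := {d | Commute d c ∧ ∃ q : ℤ, d • e = c ^ q • e}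
  one_mem' := ⟨Commute.one_left _, 0, by simp⟩
  mul_mem' := by
    rintro a b ⟨ha, p, hp⟩ ⟨hb, q, hq⟩
    refine ⟨ha.mul_left hb, q + p, ?_⟩
    rw [mul_smul, hq, smul_smul, (ha.zpow_right q).eq, mul_smul, hp, smul_smul, zpow_add]
  inv_mem' := by
    rintro a ⟨ha, p, hp⟩
    refine ⟨ha.inv_left, -p, ?_⟩
    rw [inv_smul_eq_iff, smul_smul, (ha.zpow_right (-p)).eq, mul_smul, hp, smul_smul, ← zpow_add,
      neg_add_cancel, zpow_zero, one_smul]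

theorem zpow_smul_injective {c : RAAG Γ} {e : Wall Γ} (h : ∀ n : ℤ, n ≠ 0 → c ^ n • e ≠ e)
    {p q : ℤ} (hpq : c ^ p • e = c ^ q • e) : p = q := by
  by_contra hne
  refine h (-q + p) (by omega) ?_
  rw [zpow_add, mul_smul, hpq, smul_smul, ← zpow_add, neg_add_cancel, zpow_zero, one_smul]

/-- The translation length of an element along the orbit of a wall. -/
noncomputable def translation {c : RAAG Γ} {e : Wall Γ} (h : ∀ n : ℤ, n ≠ 0 → c ^ n • e ≠ e) :
    translators c e →* Multiplicative ℤ :=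
  MonoidHom.mk' (fun d => Multiplicative.ofAdd d.2.2.choose) (by
    intro a b
    rw [← ofAdd_add]
    congr 1
    refine zpow_smul_injective h ?_
    rw [← (a * b).2.2.choose_spec, add_comm, zpow_add, mul_smul, ← a.2.2.choose_spec, smul_smul,
      ← (a.2.1.zpow_right _).eq, mul_smul, ← b.2.2.choose_spec, smul_smul]
    rfl)

theorem smul_eq_translation {c : RAAG Γ} {e : Wall Γ} (h : ∀ n : ℤ, n ≠ 0 → c ^ n • e ≠ e)
    (d : translators c e) :
    (d : RAAG Γ) • e = c ^ (Multiplicative.toAdd (translation h d)) • e :=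
  d.2.2.choose_spec

theorem Straight.exists_zpow_smul_mem {c g : RAAG Γ} (hc : Straight c) {e : Wall Γ}
    (he : crossing c e ≠ 0) (hgc : Commute g c) : ∃ q : ℤ, crossing c (c ^ q • g • e) ≠ 0 := by
  by_contra! h0
  have hstep : ∀ n : ℤ, crossing g (c ^ n • g • e) + crossing c (c ^ n • e) =
      crossing g (c ^ (n - 1) • g • e) := by
    intro n
    have h1 := crossing_mul g c (c ^ n • g • e)
    have h2 := crossing_mul c g (c ^ n • g • e)
    have h3 : g⁻¹ • c ^ n • g • e = c ^ n • e := by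
      rw [inv_smul_eq_iff, smul_smul, smul_smul, (hgc.zpow_right n).eq]
    have h4 : c⁻¹ • c ^ n • g • e = c ^ (n - 1) • g • e := by
      rw [smul_smul c⁻¹, ← zpow_neg_one, ← zpow_add, neg_add_eq_sub]
    rw [← h3, ← h1, ← h4, hgc.eq, h2, h0, zero_add]
  have hpos : ∀ n : ℕ, crossing g (c ^ n • g • e) = crossing g (g • e) := by
    intro n
    induction n with
    | zero => simp
    | succ n ih =>
      have := hstep (n + 1 : ℕ)
      rw [hc.crossing_zpow_smul he (by positivity), add_zero, zpow_natCast] at this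
      rw [this, ← ih]
      simp
  have hshift : ∀ (n : ℕ) (a : Wall Γ), c⁻¹ ^ n • c⁻¹ • a = c ^ (-(n : ℤ) - 1) • a := by
    intro n a
    rw [smul_smul, ← pow_succ, inv_pow, ← zpow_natCast, ← zpow_neg]
    congr 2
    push_cast
    ring
  have hneg : ∀ n : ℕ, crossing g (c⁻¹ ^ n • c⁻¹ • g • e) = crossing g (c⁻¹ • g • e) := by
    intro n
    induction n with
    | zero => simp
    | succ n ih =>
      have := hstep (-(n + 1 : ℕ))
      rw [hc.crossing_zpow_smul he (by simp; omega), add_zero] at this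
      rw [← ih, hshift, ← this, hshift]
      congr 3
      push_cast
      ring
  have hfree : ∀ m : ℕ, 0 < m → c ^ m • g • e ≠ g • e := by
    intro m hm h
    rw [smul_smul, ← (hgc.pow_right m).eq, mul_smul, smul_left_cancel_iff, ← zpow_natCast] at h
    exact hc.zpow_smul_ne he (by omega) h
  have h00 := hstep 0
  simp only [zpow_zero, one_smul, zero_sub, zpow_neg_one] at h00
  by_cases hF : crossing g (g • e) = 0
  · obtain ⟨m, hm, h⟩ := exists_pow_smul_eq (finite_crossing g) (c := c⁻¹) (e := c⁻¹ • g • e)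
      (fun n => by rw [Set.mem_ofPred_eq, hneg, ← h00, hF, zero_add]; exact he)
    refine hfree m hm ?_
    rw [smul_smul, ← pow_succ, pow_succ', mul_smul, smul_left_cancel_iff, inv_pow,
      inv_smul_eq_iff] at h
    exact h.symm
  · obtain ⟨m, hm, h⟩ := exists_pow_smul_eq (finite_crossing g) (c := c) (e := g • e)
      (fun n => by rw [Set.mem_ofPred_eq, hpos]; exact hF)
    exact hfree m hm h

theorem relIndex_translators_ne_zero {c : RAAG Γ} {e : Wall Γ} {O : Set (Wall Γ)} (hO : O.Finite)
    (h : ∀ g, Commute g c → ∃ q : ℤ, c ^ q • g • e ∈ O) :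
    (translators c e).relIndex (Subgroup.centralizer {c}) ≠ 0 := by
  have hcen : ∀ g ∈ Subgroup.centralizer {c}, Commute g c := fun g hg =>
    (Subgroup.mem_centralizer_singleton_iff.1 hg)
  have key : ∀ x y, Commute x c → Commute y c → ∀ p q : ℤ, c ^ p • x • e = c ^ q • y • e →
      x⁻¹ * y ∈ translators c e := by
    intro x y hx hy p q hpq
    refine ⟨hx.inv_left.mul_left hy, p - q, ?_⟩
    rw [mul_smul, inv_smul_eq_iff, smul_smul x, (hx.zpow_right _).eq, mul_smul,
      ← smul_left_cancel_iff (c ^ q), ← hpq, smul_smul (c ^ q), ← zpow_add, add_sub_cancel]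
  have := hO.to_subtype
  choose! q hq using h
  let f : Subgroup.centralizer {c} ⧸ (translators c e).subgroupOf (Subgroup.centralizer {c}) → O :=
    fun a => ⟨_, hq _ (hcen a.out a.out.2)⟩
  have hf : Function.Injective f := by
    intro a b hab
    have h1 := Subtype.mk.inj hab
    rw [← a.out_eq', ← b.out_eq']
    refine Quotient.sound' ?_
    rw [QuotientGroup.leftRel_apply, Subgroup.mem_subgroupOf]
    exact key _ _ (hcen _ a.out.2) (hcen _ b.out.2) _ _ h1
  have := Finite.of_injective f hf
  exact Subgroup.index_ne_zero_of_finite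

/-- Every element has a root-like decomposition into commuting parts, each detected by a
homomorphism on a finite-index subgroup of the centralizer. -/
theorem exists_parts [Finite V] (c : RAAG Γ) : ∃ (S : Set V) (y : V → RAAG Γ),
    (∀ N : ℕ, c ^ N ∈ Subgroup.closure ((fun v => y v ^ N) '' S)) ∧
    ∀ v ∈ S, (∀ g, Commute g c → Commute g (y v)) ∧
      ∃ (Q : Subgroup (RAAG Γ)) (φ : Q →* Multiplicative ℤ) (hcQ : c ∈ Q),
        Q.relIndex (Subgroup.centralizer {c}) ≠ 0 ∧ φ ⟨c, hcQ⟩ ≠ 1 ∧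
        ∀ d : Q, φ d ≠ 1 → ∀ e, Commute e (d : RAAG Γ) → ∃ p : ℕ, 0 < p ∧ Commute e (y v ^ p) := by
  obtain ⟨h, hst⟩ := exists_straight c
  set c₁ := h⁻¹ * c * h with hc₁
  have hpow : ∀ n : ℤ, c ^ n = h * c₁ ^ n * h⁻¹ := fun n => by
    rw [← conj_zpow, hc₁]; congr 1; group
  have hcomm : ∀ g, Commute g c → Commute (h⁻¹ * g * h) c₁ := fun g hg => by
    have := (Commute.conj_iff h⁻¹).2 hg
    rwa [inv_inv] at this
  refine ⟨supp c₁, fun v => h * part c₁ v * h⁻¹, fun N => ?_, fun v hv => ⟨fun g hg => ?_, ?_⟩⟩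
  · have := Subgroup.mem_map_of_mem (MulAut.conj h).toMonoidHom (pow_mem_closure_part c₁ N)
    rw [MonoidHom.map_closure, ← Set.image_comp] at this
    rw [← zpow_natCast, hpow, zpow_natCast]
    simp only [conj_pow]
    exact this
  · have := (Commute.conj_iff h).2 (hst.commute_part hv (hcomm g hg))
    rwa [show h * (h⁻¹ * g * h) * h⁻¹ = g by group] at this
  obtain ⟨g₀, he⟩ := exists_crossing hv
  set e := wallAt v g₀
  have hfree : ∀ n : ℤ, n ≠ 0 → c ^ n • h • e ≠ h • e := by
    intro n hn h'
    rw [hpow, smul_smul, inv_mul_cancel_right, mul_smul, smul_left_cancel_iff] at h'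
    exact hst.zpow_smul_ne he hn h'
  have hcQ : c ∈ translators c (h • e) := ⟨Commute.refl c, 1, by simp⟩
  refine ⟨translators c (h • e), translation hfree, hcQ, ?_, ?_, ?_⟩
  · refine relIndex_translators_ne_zero ((finite_crossing c₁).image (h • ·)) fun g hg => ?_
    obtain ⟨q, hq⟩ := hst.exists_zpow_smul_mem he (hcomm g hg)
    refine ⟨q, _, hq, ?_⟩
    simp only [smul_smul, hpow, mul_assoc]
  · intro h1
    have := smul_eq_translation hfree ⟨c, hcQ⟩
    rw [h1, toAdd_one, zpow_zero, one_smul] at this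
    exact hfree 1 one_ne_zero (by simpa using this)
  · intro d hd a had
    have h1 := smul_eq_translation hfree d
    obtain ⟨p, hp, hap⟩ := hst.exists_commute_pow (d := h⁻¹ * (d : RAAG Γ) * h)
      (e := h⁻¹ * a * h) (g := g₀)
      hv (hcomm _ d.2.1) (q := Multiplicative.toAdd (translation hfree d))
      (fun h0 => hd (by rw [← ofAdd_toAdd (translation hfree d), h0, ofAdd_zero]))
      (by
        rw [mul_smul, mul_smul, h1, hpow, smul_smul, smul_smul]
        congr 1
        group) (by
        have := (Commute.conj_iff h⁻¹).2 had
        rwa [inv_inv] at this)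
    refine ⟨p, hp, ?_⟩
    have := (Commute.conj_iff h).2 hap
    rw [show h * (h⁻¹ * a * h) * h⁻¹ = a by group] at this
    rwa [conj_pow]

end RAAG

/-! ### The Burau representation at `t = 2` -/

/-- The Burau matrix of a standard generator at `t = 2`, on infinite sequences. -/
def burau (i : ℕ) : (ℕ → ℚ) ≃ₗ[ℚ] (ℕ → ℚ) where
  toFun f m := if m = i then -f i + 2 * f (i + 1) else if m = i + 1 then f i else f m
  invFun f m := if m = i then f (i + 1) else if m = i + 1 then (f i + f (i + 1)) / 2 else f m
  map_add' f g := by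
    ext m
    simp only [Pi.add_apply]
    split_ifs <;> ring
  map_smul' r f := by
    ext m
    simp only [Pi.smul_apply, smul_eq_mul, RingHom.id_apply]
    split_ifs <;> ring
  left_inv f := by
    ext m
    by_cases h1 : m = i <;> by_cases h2 : m = i + 1 <;> simp [h1, h2]
  right_inv f := by
    ext m
    by_cases h1 : m = i
    · subst h1; simp; ring
    by_cases h2 : m = i + 1 <;> simp [h1, h2]

theorem burau_apply (i : ℕ) (f : ℕ → ℚ) (m : ℕ) :
    burau i f m = if m = i then -f i + 2 * f (i + 1) else if m = i + 1 then f i else f m := rfl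

theorem burau_braid (i : ℕ) :
    burau i * burau (i + 1) * burau i = burau (i + 1) * burau i * burau (i + 1) := by
  ext f m
  simp only [LinearEquiv.mul_apply, burau_apply]
  have e1 : i ≠ i + 1 + 1 := by omega
  by_cases h1 : m = i
  · subst h1; simp [e1, e1.symm]; ring
  by_cases h2 : m = i + 1
  · subst h2; simp [e1, e1.symm]
  by_cases h3 : m = i + 1 + 1
  · subst h3; simp [e1, e1.symm]
  simp [h1, h2, h3]

theorem burau_commute {i j : ℕ} (h : i + 2 ≤ j) : Commute (burau i) (burau j) := by
  ext f m
  simp only [LinearEquiv.mul_apply, burau_apply]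
  have e1 : i ≠ j := by omega
  have e2 : i ≠ j + 1 := by omega
  have e3 : i + 1 ≠ j := by omega
  have e4 : i + 1 ≠ j + 1 := by omega
  by_cases h1 : m = i
  · subst h1; simp [e1, e2, e3]
  by_cases h2 : m = i + 1
  · subst h2; simp [e1, e2, e3]
  by_cases h3 : m = j
  · subst h3; simp [e1.symm, e3.symm, e2.symm]
  by_cases h4 : m = j + 1
  · subst h4; simp [e1.symm, e2.symm, e3.symm]
  simp [h1, h2, h3, h4]

theorem burau_pow_apply (i k : ℕ) (f : ℕ → ℚ) :
    (burau i ^ k) f = ((2 + (-2) ^ k) / 3 : ℚ) • f + ((1 - (-2) ^ k) / 3 : ℚ) • burau i f := by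
  induction k with
  | zero => ext m; simp; ring
  | succ k ih =>
    rw [pow_succ', LinearEquiv.mul_apply, ih, map_add, map_smul, map_smul]
    ext m
    simp only [Pi.add_apply, Pi.smul_apply, smul_eq_mul, burau_apply]
    by_cases h1 : m = i <;> by_cases h2 : m = i + 1 <;> simp [h1, h2] <;> ring

theorem commute_burau_of_pow {z : (ℕ → ℚ) ≃ₗ[ℚ] (ℕ → ℚ)} {i k : ℕ} (hk : 0 < k)
    (h : Commute z (burau i ^ k)) : Commute z (burau i) := by
  have hb : ((1 - (-2) ^ k) / 3 : ℚ) ≠ 0 := by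
    intro h0
    have h1 : ((-2) ^ k : ℚ) = 1 := by linarith
    have h2 := congrArg abs h1
    rw [abs_pow, abs_one] at h2
    exact (one_lt_pow₀ (by norm_num : (1 : ℚ) < |-2|) hk.ne').ne' h2
  ext f m
  have h1 := congrFun (LinearEquiv.congr_fun h.eq f) m
  simp only [LinearEquiv.mul_apply, burau_pow_apply, map_add, map_smul, Pi.add_apply,
    Pi.smul_apply, smul_eq_mul] at h1
  simp only [LinearEquiv.mul_apply]
  exact mul_left_cancel₀ hb (by linarith)

/-- An eigenvector of the full twist on three strands. -/
def twistVector (m : ℕ) : ℚ := if m = 1 then 2 else if m = 2 then -1 else 0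

theorem burau_twist_apply_twistVector :
    ((burau 0 * burau 1) ^ 3) twistVector = (8 : ℚ) • twistVector := by
  ext m
  simp only [pow_succ, pow_zero, one_mul, LinearEquiv.mul_apply, burau_apply, twistVector,
    Pi.smul_apply, smul_eq_mul]
  have e1 : ∀ m : ℕ, m + 1 + 1 + 1 ≠ 2 := by omega
  rcases m with _ | _ | _ | m <;> norm_num [e1]

theorem burau_twist_pow_apply_twistVector (M : ℕ) :
    (((burau 0 * burau 1) ^ 3) ^ M) twistVector = (8 ^ M : ℚ) • twistVector := by
  induction M with
  | zero => simp
  | succ M ih =>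
    rw [pow_succ, LinearEquiv.mul_apply, burau_twist_apply_twistVector, map_smul, ih, smul_smul,
      pow_succ']

theorem burau_twist_pow_apply_three (M : ℕ) (f : ℕ → ℚ) :
    (((burau 0 * burau 1) ^ 3) ^ M) f 3 = f 3 := by
  induction M with
  | zero => simp
  | succ M ih =>
    rw [pow_succ', LinearEquiv.mul_apply, ← ih]
    generalize (((burau 0 * burau 1) ^ 3) ^ M) f = g
    simp [pow_succ, LinearEquiv.mul_apply, burau_apply]

theorem not_commute_burau_twist {M : ℕ} (hM : 0 < M) :
    ¬ Commute (((burau 0 * burau 1) ^ 3) ^ M) (burau 2) := by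
  intro h
  have h1 := congrFun (LinearEquiv.congr_fun h.eq twistVector) 3
  rw [LinearEquiv.mul_apply, LinearEquiv.mul_apply, burau_twist_pow_apply_three,
    burau_twist_pow_apply_twistVector, map_smul] at h1
  have h2 : (1 : ℚ) < 8 ^ M := one_lt_pow₀ (by norm_num) hM.ne'
  simp [burau_apply, twistVector] at h1
  linarith

/-! ### Incommensurability -/

theorem commute_twist {G : Type*} [Group G] {a b : G} (h : a * b * a = b * a * b) :
    Commute ((a * b) ^ 3) a ∧ Commute ((a * b) ^ 3) b := by
  have h0 : (a * b) ^ 3 = (a * b * a) * (a * b * a) := by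
    conv_rhs => rw [h, ← h]
    rw [pow_succ, pow_two]
    conv_rhs => rw [mul_assoc, h]
    simp only [mul_assoc]
  have h1 : SemiconjBy (a * b * a) a b := by
    rw [SemiconjBy]
    conv_lhs => rw [h]
    simp only [mul_assoc]
  have h2 : SemiconjBy (a * b * a) b a := by
    rw [SemiconjBy]
    conv_rhs => rw [h]
    simp only [mul_assoc]
  rw [h0]
  exact ⟨h2.mul_left h1, h1.mul_left h2⟩

theorem exists_conj_pow_map_ne_one {B : Type*} [Group B] {K : Subgroup B} [K.FiniteIndex]
    (φ : K →* Multiplicative ℤ) {a b c : B} (hgen : Subgroup.closure {a, b} = ⊤)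
    (hab : a * b * a = b * a * b) (hcK : c ∈ K) (hcen : ∀ g, Commute g c) (hφc : φ ⟨c, hcK⟩ ≠ 1) :
    ∃ (g : B) (m : ℕ) (h : g⁻¹ * a ^ m * g ∈ K), φ ⟨_, h⟩ ≠ 1 := by
  classical
  by_contra! hcon
  have ha : MonoidHom.transfer φ a = 1 := by
    let := K.fintypeQuotientOfFiniteIndex
    rw [MonoidHom.transfer_eq_prod_quotient_orbitRel_zpowers_quot]
    exact Finset.prod_eq_one fun q _ => hcon _ _ _
  have hb : MonoidHom.transfer φ b = 1 := by
    have := congrArg (MonoidHom.transfer φ) hab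
    simpa [ha] using this.symm
  have hker : (MonoidHom.transfer φ).ker = ⊤ := by
    rw [eq_top_iff, ← hgen, Subgroup.closure_le]
    rintro x (rfl | rfl)
    · exact ha
    · exact hb
  have hc : MonoidHom.transfer φ c = 1 := by
    rw [← MonoidHom.mem_ker, hker]; trivial
  rw [MonoidHom.transfer_eq_pow φ c fun k g₀ _ => by
    rw [((hcen g₀⁻¹).pow_right k).eq, inv_mul_cancel_right]] at hc
  have hpow : φ ⟨c, hcK⟩ ^ K.index = 1 := by
    rw [← map_pow, ← hc]; rfl
  refine hφc (Multiplicative.toAdd.injective ?_)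
  have := congrArg Multiplicative.toAdd hpow
  rw [toAdd_pow, toAdd_one, smul_eq_zero] at this
  exact this.resolve_left Subgroup.FiniteIndex.index_ne_zero

theorem exists_pow_mem_of_finiteIndex {G : Type*} [Group G] (H : Subgroup G) [H.FiniteIndex] :
    ∃ k, 0 < k ∧ ∀ x, x ^ k ∈ H :=
  ⟨H.normalCore.index, Nat.pos_of_ne_zero Subgroup.FiniteIndex.index_ne_zero,
    fun x => H.normalCore_le (H.normalCore.pow_index_mem x)⟩

theorem index_comap_ne_zero_of_commute {G A : Type*} [Group G] [Group A] {Q : Subgroup A} {c : A}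
    (hQ : Q.relIndex (Subgroup.centralizer {c}) ≠ 0) (f : G →* A) (hf : ∀ g, Commute (f g) c) :
    (Q.comap f).index ≠ 0 := by
  rw [Subgroup.index_comap]
  refine fun h => hQ (Subgroup.relIndex_eq_zero_of_le_right ?_ h)
  rintro _ ⟨g, rfl⟩
  exact Subgroup.mem_centralizer_singleton_iff.2 (hf g)

theorem exists_conj_pow_of_centralizer {G A : Type*} [Group G] [Group A] {H B : Subgroup G}
    [H.FiniteIndex] (f : H →* A) {a b c : G} (hB : Subgroup.closure {a, b} = B)
    (hab : a * b * a = b * a * b) (hcH : c ∈ H) (hcB : c ∈ B) (hcen : ∀ g ∈ B, Commute g c)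
    {Q : Subgroup A} (φ : Q →* Multiplicative ℤ) (hcQ : f ⟨c, hcH⟩ ∈ Q)
    (hQ : Q.relIndex (Subgroup.centralizer {f ⟨c, hcH⟩}) ≠ 0) (hφ : φ ⟨_, hcQ⟩ ≠ 1) :
    ∃ g ∈ B, ∃ (m : ℕ) (h : g⁻¹ * a ^ m * g ∈ H) (h' : f ⟨_, h⟩ ∈ Q), φ ⟨_, h'⟩ ≠ 1 := by
  have haB : a ∈ B := hB ▸ Subgroup.subset_closure (by simp)
  have hbB : b ∈ B := hB ▸ Subgroup.subset_closure (by simp)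
  let j : H.comap B.subtype →* H := B.subtype.subgroupComap H
  let K : Subgroup B :=
    { carrier := {x | ∃ h : (x : G) ∈ H, f ⟨x, h⟩ ∈ Q}
      one_mem' := ⟨one_mem H, by
        have := map_one f
        exact this ▸ one_mem Q⟩
      mul_mem' := by
        rintro x y ⟨hx, hx'⟩ ⟨hy, hy'⟩
        refine ⟨mul_mem hx hy, ?_⟩
        have := mul_mem hx' hy'
        rwa [← map_mul] at this
      inv_mem' := by
        rintro x ⟨hx, hx'⟩
        refine ⟨inv_mem hx, ?_⟩
        have := inv_mem hx'
        rwa [← map_inv] at this }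
  have hK : K = (Q.comap (f.comp j)).map (H.comap B.subtype).subtype := by
    ext x
    constructor
    · rintro ⟨h, h'⟩
      exact ⟨⟨x, h⟩, h', rfl⟩
    · rintro ⟨⟨y, h⟩, h', rfl⟩
      exact ⟨h, h'⟩
  have : (H.comap B.subtype).FiniteIndex := inferInstanceAs (H.subgroupOf B).FiniteIndex
  have hfin : K.FiniteIndex := ⟨by
    rw [hK, Subgroup.index_map_subtype]
    refine mul_ne_zero (index_comap_ne_zero_of_commute hQ _ fun x => ?_)
      Subgroup.FiniteIndex.index_ne_zero
    have h0 : Commute (j x) (⟨c, hcH⟩ : H) := Subtype.ext (hcen x x.1.2).eq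
    exact h0.map f⟩
  let ψ : K →* Multiplicative ℤ :=
    MonoidHom.mk' (fun x => φ ⟨f ⟨x, x.2.choose⟩, x.2.choose_spec⟩) (by
      intro x y
      rw [← map_mul]
      congr 1
      exact Subtype.ext (map_mul f ⟨x, x.2.choose⟩ ⟨y, y.2.choose⟩))
  have hgen : Subgroup.closure {(⟨a, haB⟩ : B), ⟨b, hbB⟩} = ⊤ := by
    subst hB
    rw [eq_top_iff, ← Subgroup.closure_closure_coe_preimage]
    refine Subgroup.closure_mono ?_
    rintro x (hx | hx)
    · exact Or.inl (Subtype.ext hx)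
    · exact Or.inr (Subtype.ext hx)
  obtain ⟨g, m, h, hne⟩ := exists_conj_pow_map_ne_one ψ (c := ⟨c, hcB⟩) hgen (Subtype.ext hab)
    ⟨hcH, hcQ⟩ (fun g => Subtype.ext (hcen g g.2)) hφ
  exact ⟨g, g.2, m, h.choose, h.choose_spec, hne⟩

theorem not_commensurable_of_burau {G : Type*} [Group G] {V : Type*} [Finite V]
    (Γ : SimpleGraph V) (ρ : G →* ((ℕ → ℚ) ≃ₗ[ℚ] (ℕ → ℚ))) {a b s : G}
    (hab : a * b * a = b * a * b) (has : Commute a s) (ha : ρ a = burau 0) (hb : ρ b = burau 1)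
    (hs : ρ s = burau 2) : ¬ AbstractlyCommensurable G (RAAG Γ) := by
  rintro ⟨H, H', hH, hH', ⟨ι⟩⟩
  set f : H →* RAAG Γ := H'.subtype.comp ι.toMonoidHom with hf
  have hfinj : Function.Injective f := H'.subtype_injective.comp ι.injective
  obtain ⟨k, hk, hkH⟩ := exists_pow_mem_of_finiteIndex H
  obtain ⟨k', hk', hkH'⟩ := exists_pow_mem_of_finiteIndex H'
  set B := Subgroup.closure {a, b} with hB
  have haB : a ∈ B := Subgroup.subset_closure (by simp)
  have hbB : b ∈ B := Subgroup.subset_closure (by simp)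
  obtain ⟨hca, hcb⟩ := commute_twist hab
  set c := (a * b) ^ 3 with hc
  have hcB : c ∈ B := pow_mem (mul_mem haB hbB) 3
  have hcen : ∀ g ∈ B, Commute g c := by
    have : B ≤ Subgroup.centralizer {c} := by
      rw [hB, Subgroup.closure_le]
      rintro x (rfl | rfl)
      · exact Subgroup.mem_centralizer_singleton_iff.2 hca.symm
      · exact Subgroup.mem_centralizer_singleton_iff.2 hcb.symm
    exact fun g hg => Subgroup.mem_centralizer_singleton_iff.1 (this hg)
  obtain ⟨S, y, hy, hS⟩ := RAAG.exists_parts (f ⟨c ^ k, hkH c⟩)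
  by_cases hbad : ∀ v ∈ S, ∃ g ∈ B, ∃ q : ℕ, 0 < q ∧
      Commute (f ⟨(g⁻¹ * s * g) ^ k, hkH _⟩) (y v ^ q)
  · choose! g hg q hq hcomm using hbad
    have hSfin := S.toFinite
    set N := k' * ∏ v ∈ hSfin.toFinset, q v with hN
    have hNpos : 0 < N := Nat.mul_pos hk' (Finset.prod_pos fun v hv =>
      hq v (hSfin.mem_toFinset.1 hv))
    have hyN : ∀ v ∈ S, y v ^ N ∈ H' := fun v _ => by
      rw [hN, pow_mul]; exact pow_mem (hkH' _) _
    have hz : ∀ v ∈ S, ∃ z : H, f z = y v ^ N := fun v hv =>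
      ⟨ι.symm ⟨_, hyN v hv⟩, by simp [hf]⟩
    choose! z hz using hz
    have hpull : ∀ v ∈ S, ∀ x : H, Commute (f x) (y v ^ N) → Commute (z v : G) x := by
      intro v hv x hx
      rw [← hz v hv] at hx
      have : Commute x (z v) := hfinj (by rw [map_mul, map_mul]; exact hx.eq)
      exact (this.map H.subtype).symm
    have hzB : ∀ v ∈ S, ∀ x ∈ B, Commute (z v : G) (x ^ k) := by
      intro v hv x hx
      have h0 : Commute (⟨x ^ k, hkH x⟩ : H) ⟨c ^ k, hkH c⟩ :=
        Subtype.ext ((hcen x hx).pow_pow k k).eq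
      exact hpull v hv ⟨x ^ k, hkH x⟩ (((hS v hv).1 _ (h0.map f)).pow_right N)
    have hρz : ∀ v ∈ S, Commute (ρ (z v)) (burau 2) := by
      intro v hv
      have h0 : Commute (ρ (z v)) (ρ a) := by
        have := (hzB v hv a haB).map ρ
        rw [map_pow, ha] at this
        rw [ha]
        exact commute_burau_of_pow hk this
      have h1 : Commute (ρ (z v)) (ρ b) := by
        have := (hzB v hv b hbB).map ρ
        rw [map_pow, hb] at this
        rw [hb]
        exact commute_burau_of_pow hk this
      have h2 : ∀ x ∈ B, Commute (ρ (z v)) (ρ x) := by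
        have : B ≤ (Subgroup.centralizer {ρ (z v)}).comap ρ := by
          rw [hB, Subgroup.closure_le]
          rintro x (rfl | rfl)
          · exact Subgroup.mem_centralizer_singleton_iff.2 h0.symm
          · exact Subgroup.mem_centralizer_singleton_iff.2 h1.symm
        exact fun x hx => (Subgroup.mem_centralizer_singleton_iff.1 (this hx) : Commute _ _).symm
      have h3 : Commute (z v : G) ((g v)⁻¹ * s ^ k * g v) := by
        have hdvd : q v ∣ N :=
          (Finset.dvd_prod_of_mem q (hSfin.mem_toFinset.2 hv)).mul_left k'
        obtain ⟨r, hr⟩ := hdvd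
        have := hpull v hv _ (by rw [hr, pow_mul]; exact (hcomm v hv).pow_right r)
        have hconj := conj_pow (i := k) (a := (g v)⁻¹) (b := s)
        rw [inv_inv] at hconj
        rwa [← hconj]
      have h4 : Commute (ρ (z v)) (ρ (s ^ k)) := by
        have h5 := h2 _ (hg v hv)
        have := (h5.mul_right (h3.map ρ)).mul_right h5.inv_right
        rwa [← map_inv, ← map_mul, ← map_mul,
          show g v * ((g v)⁻¹ * s ^ k * g v) * (g v)⁻¹ = s ^ k by group] at this
      rw [map_pow, hs] at h4
      exact commute_burau_of_pow hk h4
    have hmem : (⟨c ^ k, hkH c⟩ : H) ^ N ∈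
        ((Subgroup.centralizer {burau 2}).comap ρ).comap H.subtype := by
      have h1 := hy N
      rw [← map_pow, Set.image_congr (g := f ∘ z) fun v hv => (hz v hv).symm, Set.image_comp,
        ← MonoidHom.map_closure, Subgroup.mem_map_iff_mem hfinj] at h1
      refine (Subgroup.closure_le _).2 ?_ h1
      rintro _ ⟨v, hv, rfl⟩
      exact Subgroup.mem_centralizer_singleton_iff.2 (hρz v hv)
    refine not_commute_burau_twist (Nat.mul_pos hk hNpos) ?_
    have := Subgroup.mem_centralizer_singleton_iff.1 hmem
    rw [← ha, ← hb, ← map_mul, ← map_pow, ← map_pow, pow_mul]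
    exact this
  · push Not at hbad
    obtain ⟨v, hv, hbad⟩ := hbad
    obtain ⟨-, Q, φ, hcQ, hQ, hφ, hcom⟩ := hS v hv
    obtain ⟨g, hg, m, h, h', hne⟩ := exists_conj_pow_of_centralizer f hB.symm hab (hkH c)
      (pow_mem hcB k) (fun g hg => (hcen g hg).pow_right k) φ hcQ hQ hφ
    obtain ⟨p, hp, hcomm⟩ := hcom _ hne (f ⟨(g⁻¹ * s * g) ^ k, hkH _⟩) (by
      refine Commute.map (f := f) (Subtype.ext ?_)
      have h1 := (Commute.conj_iff g⁻¹).2 (has.symm.pow_pow k m)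
      have hconj := conj_pow (i := k) (a := g⁻¹) (b := s)
      rw [inv_inv] at h1 hconj
      rw [← hconj] at h1
      exact h1)
    exact hbad g hg p hp hcomm

/-- The Burau representation of the braid group at `t = 2`, stabilized to infinite sequences. -/
def burauRep (n : ℕ) : BraidGroup n →* ((ℕ → ℚ) ≃ₗ[ℚ] (ℕ → ℚ)) :=
  PresentedGroup.toGroup (f := fun i : Fin (n - 1) => burau i) (by
    rintro r (⟨i, j, hij, rfl⟩ | ⟨i, j, hij, rfl⟩)
    · simp only [map_mul, map_inv, FreeGroup.lift_apply_of, ← hij]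
      rw [mul_inv_eq_one]
      exact burau_braid i
    · simp only [map_mul, map_inv, FreeGroup.lift_apply_of]
      exact commutatorElement_eq_one_iff_commute.2 (burau_commute hij))

theorem burauRep_of (n : ℕ) (i : Fin (n - 1)) : burauRep n (PresentedGroup.of i) = burau i :=
  PresentedGroup.toGroup.of _

theorem braidGroup_braid {n : ℕ} {i j : Fin (n - 1)} (h : (i : ℕ) + 1 = j) :
    (PresentedGroup.of i * PresentedGroup.of j * PresentedGroup.of i : BraidGroup n) =
      PresentedGroup.of j * PresentedGroup.of i * PresentedGroup.of j := by
  have h1 : PresentedGroup.mk (braidRels n) _ = 1 :=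
    PresentedGroup.one_of_mem (Or.inl ⟨i, j, h, rfl⟩)
  simp only [map_mul, map_inv] at h1
  exact mul_inv_eq_one.1 h1

theorem braidGroup_commute {n : ℕ} {i j : Fin (n - 1)} (h : (i : ℕ) + 2 ≤ j) :
    Commute (PresentedGroup.of i : BraidGroup n) (PresentedGroup.of j) := by
  have h1 : PresentedGroup.mk (braidRels n) _ = 1 :=
    PresentedGroup.one_of_mem (Or.inr ⟨i, j, h, rfl⟩)
  simp only [map_mul, map_inv] at h1
  exact commutatorElement_eq_one_iff_commute.1 h1

/-- For `n ≥ 4`, the braid group on `n` strands is not abstractly commensurable with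
any right-angled Artin group. -/
theorem braid_not_commensurable_raag (n : ℕ) (hn : 4 ≤ n) :
    ∀ {V : Type} [Fintype V] (Γ : SimpleGraph V),
      ¬ AbstractlyCommensurable (BraidGroup n) (RAAG Γ) := by
  intro V _ Γ
  exact not_commensurable_of_burau Γ (burauRep n)
    (a := PresentedGroup.of ⟨0, by omega⟩) (b := PresentedGroup.of ⟨1, by omega⟩)
    (s := PresentedGroup.of ⟨2, by omega⟩) (braidGroup_braid rfl) (braidGroup_commute le_rfl)
    (burauRep_of n _) (burauRep_of n _) (burauRep_of n _)
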